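/- arXiv:2311.02784 — 6 statements merged into one kernel-verified Lean document; each statement's English description precedes it below -/
import Mathlib

section
/- Let H be a finitely generated subgroup of a finitely generated free group F_n and let A ≤ F_n be a free factor. Then H ∩ A is a free factor of H. -/
/-- `s` is a free basis of the group `G`: the induced map from the free group is bijective. -/
def IsFreeBasis {G : Type} [Group G] {ι : Type} (s : ι → G) : Prop :=
  Function.Bijective (FreeGroup.lift s)

/-- `s` is a free basis of the subgroup `H` of `G`. -/
def IsBasisOf {G : Type} [Group G] {ι : Type} (s : ι → G) (H : Subgroup G) : Prop :=
  Function.Injective (FreeGroup.lift s) ∧ Subgroup.closure (Set.range s) = H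

/-- `A` is a free factor of `G`: `G` is the internal free product of `A` with some subgroup `B`. -/
def IsFreeFactor {G : Type} [Group G] (A : Subgroup G) : Prop :=
  ∃ B : Subgroup G, Function.Bijective (Monoid.Coprod.lift A.subtype B.subtype)

/-- `A` is a free factor of the subgroup `H` of `G`. -/
def IsFreeFactorIn {G : Type} [Group G] (A H : Subgroup G) : Prop :=
  A ≤ H ∧ IsFreeFactor (A.subgroupOf H)

/-- The subgroup `H` is a free group of rank `r`. -/
def HasRank {G : Type} [Group G] (H : Subgroup G) (r : ℕ) : Prop :=
  Nonempty (FreeGroup (Fin r) ≃* H)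

/-- The subgroup generated by the first `i` elements of the family `b`. -/
def prefixSubgroup {G : Type} [Group G] {n : ℕ} (b : Fin n → G) (i : ℕ) : Subgroup G :=
  Subgroup.closure (b '' {j | (j : ℕ) < i})

/-- `b` is an echelon basis for the subgroup `H`: it is a basis of the ambient group and
the ranks of the intersections with the prefix subgroups grow by at most one at each step. -/
def IsEchelonBasis {G : Type} [Group G] {n : ℕ} (b : Fin n → G) (H : Subgroup G) : Prop :=
  IsFreeBasis b ∧ ∀ i : Fin n, ∃ r r' : ℕ,
    HasRank (H ⊓ prefixSubgroup b (i : ℕ)) r' ∧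
    HasRank (H ⊓ prefixSubgroup b ((i : ℕ) + 1)) r ∧ r ≤ r' + 1

/-- `H` is an echelon subgroup: the ambient group admits an ordered basis which is an
echelon basis for `H`. -/
def IsEchelon {G : Type} [Group G] (H : Subgroup G) : Prop :=
  ∃ (m : ℕ) (b : Fin m → G), IsEchelonBasis b H

/-- `B` is the free factor support of `H`: the minimal (by inclusion) free factor containing `H`. -/
def IsFFSupport {G : Type} [Group G] (H B : Subgroup G) : Prop :=
  IsFreeFactor B ∧ H ≤ B ∧ ∀ B' : Subgroup G, IsFreeFactor B' → H ≤ B' → B ≤ B'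

/-- A complement given by a group hom suffices for being a free factor. -/
theorem freeFactor_of_hom {G N : Type} [Group G] [Group N] (K : Subgroup G) (f : N →* G)
    (h : Function.Bijective (Monoid.Coprod.lift K.subtype f)) : IsFreeFactor K := by
  have hf : Function.Injective f := by
    intro x y hxy
    have h1 : Monoid.Coprod.lift K.subtype f (Monoid.Coprod.inr x)
        = Monoid.Coprod.lift K.subtype f (Monoid.Coprod.inr y) := by simpa using hxy
    exact Monoid.Coprod.inr_injective (h.1 h1)
  refine ⟨f.range, ?_⟩
  let e : N ≃* f.range := MonoidHom.ofInjective hf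
  let E : Monoid.Coprod K N ≃* Monoid.Coprod K f.range :=
    MulEquiv.coprodCongr (MulEquiv.refl K) e
  have hE : (Monoid.Coprod.lift K.subtype f)
      = (Monoid.Coprod.lift K.subtype f.range.subtype).comp E.toMonoidHom := by
    ext x
    · simp [E]
    · simp [E, e]
      rfl
  have h2 : ⇑(Monoid.Coprod.lift K.subtype f)
      = ⇑(Monoid.Coprod.lift K.subtype f.range.subtype) ∘ ⇑E := by
    rw [hE]; rfl
  rw [h2] at h
  exact (Function.Bijective.of_comp_iff _ E.bijective).1 h

theorem exists_transversal {G Q : Type} [Group G] [MulAction G Q] (d : Q → ℕ) (P : Q → Prop)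
    (a : Q → G) (σ : Q → G) (hσ : ∀ q, ¬ P q → d ((σ q)⁻¹ • q) < d q) :
    ∃ t : Q → G, (∀ q, P q → t q = a q) ∧ (∀ q, ¬ P q → t q = σ q * t ((σ q)⁻¹ • q)) := by
  classical
  let wf : WellFounded (fun x y : Q => d x < d y) := (measure d).wf
  let F : (q : Q) → ((y : Q) → d y < d q → G) → G := fun q rec =>
    if h : P q then a q else σ q * rec ((σ q)⁻¹ • q) (hσ q h)
  refine ⟨wf.fix F, fun q hq => ?_, fun q hq => ?_⟩
  · rw [wf.fix_eq]; simp [F, hq]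
  · rw [wf.fix_eq]; simp [F, hq]

/-- Levels of vertices at bounded distance from the set `P`. -/
def Lev {G Q S : Type} [Group G] [MulAction G Q] (s : S → G) (P : Q → Prop) : ℕ → Q → Prop
  | 0, q => P q
  | n + 1, q => ∃ i, Lev s P n ((s i)⁻¹ • q) ∨ Lev s P n (s i • q)

theorem exists_lev {G Q S : Type} [Group G] [MulAction G Q] (s : S → G) (P : Q → Prop)
    (hs : Subgroup.closure (Set.range s) = ⊤) (q0 : Q) (h0 : P q0) (g : G) :
    ∃ n, Lev s P n (g • q0) := by
  have hg : g ∈ Subgroup.closure (Set.range s) := by rw [hs]; trivial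
  induction hg using Subgroup.closure_induction_left with
  | one => exact ⟨0, by simpa [Lev] using h0⟩
  | mul_left x hx y hy ih =>
    obtain ⟨i, rfl⟩ := hx
    obtain ⟨n, hn⟩ := ih
    exact ⟨n + 1, i, Or.inl (by simpa [mul_smul] using hn)⟩
  | inv_mul_cancel x hx y hy ih =>
    obtain ⟨i, rfl⟩ := hx
    obtain ⟨n, hn⟩ := ih
    exact ⟨n + 1, i, Or.inr (by simpa [mul_smul] using hn)⟩

theorem exists_cocycle {G Q S M : Type} [Group G] [MulAction G Q] [Group M] (s : S → G)
    (hs : Subgroup.closure (Set.range s) = ⊤)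
    (ext : ∀ (N : Type) [Group N] (f : S → N), ∃ φ : G →* N, ∀ i, φ (s i) = f i)
    (c : S → Q → M) :
    ∃ C : G → Q → M, (∀ i q, C (s i) q = c i q) ∧
      ∀ g h q, C (g * h) q = C g (h • q) * C h q := by
  let f : S → Equiv.Perm (Q × M) := fun i =>
    { toFun := fun p => (s i • p.1, c i p.1 * p.2)
      invFun := fun p => ((s i)⁻¹ • p.1, (c i ((s i)⁻¹ • p.1))⁻¹ * p.2)
      left_inv := fun p => by simp
      right_inv := fun p => by simp }
  obtain ⟨φ, hφ⟩ := ext _ f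
  have key : ∀ g : G, ∃ D : Q → M, ∀ q m, φ g (q, m) = (g • q, D q * m) := by
    intro g
    have hg : g ∈ Subgroup.closure (Set.range s) := by rw [hs]; trivial
    induction hg using Subgroup.closure_induction with
    | mem x hx =>
      obtain ⟨i, rfl⟩ := hx
      exact ⟨c i, fun q m => by rw [hφ]; rfl⟩
    | one => exact ⟨fun _ => 1, fun q m => by simp⟩
    | mul x y _ _ hx hy =>
      obtain ⟨D, hD⟩ := hx
      obtain ⟨E, hE⟩ := hy
      refine ⟨fun q => D (y • q) * E q, fun q m => ?_⟩
      rw [map_mul, Equiv.Perm.mul_apply, hE, hD, mul_smul, mul_assoc]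
    | inv x _ hx =>
      obtain ⟨D, hD⟩ := hx
      refine ⟨fun q => (D (x⁻¹ • q))⁻¹, fun q m => ?_⟩
      rw [map_inv, Equiv.Perm.inv_eq_iff_eq, hD]
      simp
  choose C hC using key
  refine ⟨C, fun i q => ?_, fun g h q => ?_⟩
  · have h1 := hC (s i) q 1
    rw [hφ] at h1
    have h2 := congrArg Prod.snd h1
    simpa [f] using h2.symm
  · have h1 := hC (g * h) q 1
    rw [map_mul, Equiv.Perm.mul_apply, hC, hC] at h1
    have h2 := congrArg Prod.snd h1
    simpa using h2.symm

theorem core {G S : Type} [Group G] (s : S → G) (X : Set S)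
    (hs : Subgroup.closure (Set.range s) = ⊤)
    (ext : ∀ (N : Type) [Group N] (f : S → N), ∃ φ : G →* N, ∀ i, φ (s i) = f i)
    (H A : Subgroup G) (hA : Subgroup.closure (s '' X) = A) :
    IsFreeFactor ((H ⊓ A).subgroupOf H) := by
  classical
  let Q := G ⧸ H
  let q0 : Q := ((1 : G) : G ⧸ H)
  have stab : ∀ g : G, g • q0 = q0 ↔ g ∈ H := by
    intro g
    have : g • q0 = ((g : G) : G ⧸ H) := by
      change ((g * 1 : G) : G ⧸ H) = _
      rw [mul_one]
    rw [this]
    change ((g : G) : G ⧸ H) = ((1 : G) : G ⧸ H) ↔ _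
    rw [eq_comm, QuotientGroup.eq]; simp
  have trans : ∀ q : Q, ∃ g : G, g • q0 = q := by
    intro q
    exact MulAction.exists_smul_eq G q0 q
  let P : Q → Prop := fun q => ∃ a ∈ A, a • q0 = q
  have hP0 : P q0 := ⟨1, A.one_mem, one_smul _ _⟩
  have hPA : ∀ a ∈ A, ∀ q, P q → P (a • q) := by
    rintro a ha q ⟨b, hb, rfl⟩
    exact ⟨a * b, A.mul_mem ha hb, mul_smul _ _ _⟩
  have hlev : ∀ q : Q, ∃ n, Lev s P n q := by
    intro q
    obtain ⟨g, rfl⟩ := trans q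
    exact exists_lev s P hs q0 hP0 g
  let d : Q → ℕ := fun q => Nat.find (hlev q)
  have hσ : ∀ q, ∃ σ : G, ¬ P q → (∃ i, σ = s i ∨ σ = (s i)⁻¹) ∧ d (σ⁻¹ • q) < d q := by
    intro q
    by_cases hq : P q
    · exact ⟨1, fun h => absurd hq h⟩
    have h1 : Lev s P (d q) q := Nat.find_spec (hlev q)
    rcases hd : d q with _ | n
    · rw [hd] at h1; exact absurd h1 hq
    · rw [hd] at h1
      obtain ⟨i, h | h⟩ := h1
      · exact ⟨s i, fun _ => ⟨⟨i, Or.inl rfl⟩, Nat.lt_succ_of_le (Nat.find_min' _ h)⟩⟩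
      · exact ⟨(s i)⁻¹, fun _ => ⟨⟨i, Or.inr rfl⟩,
          Nat.lt_succ_of_le (Nat.find_min' _ (by simpa using h))⟩⟩
  choose σ hσ using hσ
  have ha : ∀ q : Q, ∃ a : G, (P q → a ∈ A ∧ a • q0 = q) ∧ (q = q0 → a = 1) := by
    intro q
    by_cases h : q = q0
    · exact ⟨1, fun _ => ⟨A.one_mem, by rw [h, one_smul]⟩, fun _ => rfl⟩
    · by_cases hq : P q
      · obtain ⟨a, ha, hb⟩ := hq
        exact ⟨a, fun _ => ⟨ha, hb⟩, fun h' => absurd h' h⟩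
      · exact ⟨1, fun h' => absurd h' hq, fun h' => absurd h' h⟩
  choose a ha ha0 using ha
  obtain ⟨t, htP, htN⟩ := exists_transversal d P a σ (fun q hq => (hσ q hq).2)
  have t0 : t q0 = 1 := by rw [htP _ hP0, ha0 _ rfl]
  have tA : ∀ q, P q → t q ∈ A := fun q hq => by rw [htP _ hq]; exact (ha q hq).1
  have tq : ∀ n, ∀ q, d q = n → t q • q0 = q := by
    intro n
    induction n using Nat.strong_induction_on with
    | _ n ih =>
      intro q hq
      by_cases hp : P q
      · rw [htP _ hp]; exact (ha q hp).2
      · rw [htN _ hp, mul_smul, ih _ (hq ▸ (hσ q hp).2) _ rfl, smul_inv_smul]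
  have tq : ∀ q, t q • q0 = q := fun q => tq _ q rfl
  let u : G → Q → G := fun g q => (t (g • q))⁻¹ * g * t q
  have uH : ∀ g q, u g q ∈ H := by
    intro g q
    rw [← stab]
    simp only [u, mul_smul, tq]
    rw [inv_smul_eq_iff, tq]
  have uA : ∀ g ∈ A, ∀ q, P q → u g q ∈ A := fun g hg q hq =>
    A.mul_mem (A.mul_mem (A.inv_mem (tA _ (hPA g hg q hq))) hg) (tA q hq)
  have umul : ∀ g h q, u (g * h) q = u g (h • q) * u h q := by
    intro g h q
    simp only [u, mul_smul]; group
  let K := (H ⊓ A).subgroupOf H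
  let W := {w : S × Q // ¬ (u (s w.1) w.2 = 1) ∧ ¬ (w.1 ∈ X ∧ P w.2)}
  have sA : ∀ i ∈ X, s i ∈ A := fun i hi => hA ▸ Subgroup.subset_closure ⟨i, hi, rfl⟩
  let M := Monoid.Coprod K (FreeGroup W)
  let c : S → Q → M := fun i q =>
    if h1 : u (s i) q = 1 then 1 else
    if h2 : i ∈ X ∧ P q then
      Monoid.Coprod.inl ⟨⟨u (s i) q, uH _ _⟩, Subgroup.mem_subgroupOf.2
        ⟨uH _ _, uA _ (sA i h2.1) q h2.2⟩⟩
    else Monoid.Coprod.inr (FreeGroup.of ⟨(i, q), h1, h2⟩)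
  obtain ⟨C, hC, Cmul⟩ := exists_cocycle s hs ext c
  have Cone : ∀ q, C 1 q = 1 := by
    intro q
    have := Cmul 1 1 q
    rw [one_smul, mul_one] at this
    exact left_eq_mul.1 this
  have Cinv : ∀ g q, C g⁻¹ q = (C g (g⁻¹ • q))⁻¹ := by
    intro g q
    have := Cmul g g⁻¹ q
    rw [mul_inv_cancel, Cone] at this
    exact eq_inv_of_mul_eq_one_right this.symm
  have uone : ∀ q, u 1 q = 1 := by intro q; simp [u]
  have uinv : ∀ g q, u g⁻¹ q = (u g (g⁻¹ • q))⁻¹ := by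
    intro g q
    simp [u, mul_assoc]
  let fW : FreeGroup W →* H := FreeGroup.lift fun w => ⟨u (s w.1.1) w.1.2, uH _ _⟩
  let θ : M →* H := Monoid.Coprod.lift K.subtype fW
  have θl : ∀ k : K, θ (Monoid.Coprod.inl k) = (k : H) := fun k =>
    Monoid.Coprod.lift_apply_inl K.subtype fW k
  have θr : ∀ w : W, ((θ (Monoid.Coprod.inr (FreeGroup.of w)) : H) : G)
      = u (s w.1.1) w.1.2 := fun w =>
    congrArg Subtype.val ((Monoid.Coprod.lift_apply_inr K.subtype fW (FreeGroup.of w)).trans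
      (FreeGroup.lift_apply_of ..))
  have θC : ∀ g : G, ∀ q, ((θ (C g q) : H) : G) = u g q := by
    intro g
    have hg : g ∈ Subgroup.closure (Set.range s) := by rw [hs]; trivial
    induction hg using Subgroup.closure_induction with
    | mem x hx =>
      obtain ⟨i, rfl⟩ := hx
      intro q
      rw [hC]
      by_cases h1 : u (s i) q = 1
      · simp [c, h1]
      · by_cases h2 : i ∈ X ∧ P q
        · simp only [c, dif_neg h1, dif_pos h2]; rw [θl]
        · simp only [c, dif_neg h1, dif_neg h2]; rw [θr]
    | one => intro q; rw [Cone, uone]; simp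
    | mul x y _ _ hx hy => intro q; rw [Cmul, map_mul, Subgroup.coe_mul, hx, hy, umul]
    | inv x _ hx => intro q; rw [Cinv, map_inv, Subgroup.coe_inv, hx, uinv]
  have CA : ∀ g ∈ A, ∀ q, P q → ∃ k : K, ((k : H) : G) = u g q ∧ C g q = Monoid.Coprod.inl k := by
    intro g hg
    rw [← hA] at hg
    induction hg using Subgroup.closure_induction with
    | mem x hx =>
      obtain ⟨i, hi, rfl⟩ := hx
      intro q hq
      rw [hC]
      by_cases h1 : u (s i) q = 1
      · exact ⟨1, by simp [h1], by simp [c, h1]⟩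
      · refine ⟨⟨⟨u (s i) q, uH _ _⟩, Subgroup.mem_subgroupOf.2
          ⟨uH _ _, uA _ (sA i hi) q hq⟩⟩, rfl, ?_⟩
        simp only [c, dif_neg h1, dif_pos (And.intro hi hq)]
    | one => intro q _; exact ⟨1, by simp [uone], by simp [Cone]⟩
    | mul x y hx' hy' hx hy =>
      intro q hq
      rw [hA] at hy'
      obtain ⟨k, hk, hk'⟩ := hx _ (hPA y hy' q hq)
      obtain ⟨l, hl, hl'⟩ := hy q hq
      exact ⟨k * l, by simp [hk, hl, umul], by rw [Cmul, hk', hl', map_mul]⟩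
    | inv x hx' hx =>
      intro q hq
      rw [hA] at hx'
      obtain ⟨k, hk, hk'⟩ := hx _ (hPA _ (A.inv_mem hx') q hq)
      exact ⟨k⁻¹, by simp [hk, uinv], by rw [Cinv, hk', map_inv]⟩
  have Ct : ∀ n, ∀ q, d q = n → C (t q) q0 = 1 := by
    intro n
    induction n using Nat.strong_induction_on with
    | _ n ih =>
      intro q hq
      by_cases hp : P q
      · obtain ⟨k, hk, hk'⟩ := CA _ (tA q hp) q0 hP0
        have : k = 1 := by
          apply Subtype.ext
          apply Subtype.ext
          rw [hk]; simp [u, tq, t0]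
        rw [hk', this, map_one]
      · have h1 := htN q hp
        obtain ⟨⟨i, hi⟩, h2⟩ := hσ q hp
        rw [h1, Cmul, ih _ (hq ▸ h2) _ rfl, tq, mul_one]
        rcases hi with hi | hi
        · rw [hi] at h1 ⊢
          rw [hC]
          have : u (s i) ((s i)⁻¹ • q) = 1 := by
            simp only [u, smul_inv_smul]
            rw [mul_assoc, ← h1, inv_mul_cancel]
          simp [c, this]
        · rw [hi] at h1 ⊢
          rw [inv_inv] at h1 ⊢
          rw [Cinv, inv_smul_smul, hC]
          have : u (s i) q = 1 := by
            simp only [u]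
            rw [h1]; group
          simp [c, this]
  have Ct : ∀ q, C (t q) q0 = 1 := fun q => Ct _ q rfl
  let ψ : H →* M :=
    { toFun := fun h => C h q0
      map_one' := Cone _
      map_mul' := fun x y => by
        rw [Subgroup.coe_mul, Cmul, (stab y).2 y.2] }
  have θψ : ∀ h, θ (ψ h) = h := by
    intro h
    apply Subtype.ext
    change ((θ (C h q0) : H) : G) = h
    rw [θC]
    simp only [u]
    rw [(stab h).2 h.2, t0]; simp
  have ψθ : ψ.comp θ = MonoidHom.id M := by
    apply Monoid.Coprod.hom_ext
    · ext k
      change C (((θ (Monoid.Coprod.inl k)) : H) : G) q0 = Monoid.Coprod.inl k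
      have : θ (Monoid.Coprod.inl k) = (k : H) := θl k
      rw [this]
      have hkA : ((k : H) : G) ∈ A := (Subgroup.mem_subgroupOf.1 k.2).2
      obtain ⟨l, hl, hl'⟩ := CA _ hkA q0 hP0
      rw [hl']
      congr 1
      apply Subtype.ext
      apply Subtype.ext
      rw [hl]
      simp only [u]
      rw [(stab _).2 (k : H).2, t0]; simp
    · ext w
      change C (((θ (Monoid.Coprod.inr (FreeGroup.of w))) : H) : G) q0
        = Monoid.Coprod.inr (FreeGroup.of w)
      have : ((θ (Monoid.Coprod.inr (FreeGroup.of w)) : H) : G) = u (s w.1.1) w.1.2 := θr w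
      rw [this]
      obtain ⟨⟨i, q⟩, h1, h2⟩ := w
      simp only [u]
      rw [Cmul, Cmul, Ct, Cinv, tq, hC]
      have h3 : (t (s i • q))⁻¹ • s i • q = q0 := by rw [inv_smul_eq_iff, tq]
      rw [h3, Ct]
      simp only [c, dif_neg h1, dif_neg h2]
      simp
  apply freeFactor_of_hom K fW
  change Function.Bijective θ
  refine ⟨fun x y h => ?_, fun h => ⟨_, θψ h⟩⟩
  have h1 := DFunLike.congr_fun ψθ x
  have h2 := DFunLike.congr_fun ψθ y
  simp only [MonoidHom.comp_apply, MonoidHom.id_apply] at h1 h2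
  rw [← h1, ← h2, h]

theorem basis_closure {G I : Type} [Group G] (b : FreeGroupBasis I G) :
    Subgroup.closure (Set.range b) = ⊤ := by
  have h := FreeGroup.closure_range_of I
  have h1 := congrArg (Subgroup.map b.repr.symm.toMonoidHom) h
  rw [MonoidHom.map_closure, ← Set.range_comp, Subgroup.map_top_of_surjective _
    b.repr.symm.surjective] at h1
  exact h1

theorem statement1 {n : ℕ} (H A : Subgroup (FreeGroup (Fin n))) (hH : H.FG)
    (hA : IsFreeFactor A) : IsFreeFactorIn (H ⊓ A) H := by
  refine ⟨inf_le_left, ?_⟩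
  obtain ⟨B, hB⟩ := hA
  let bA := IsFreeGroup.basis A
  let bB := IsFreeGroup.basis B
  let s : IsFreeGroup.Generators A ⊕ IsFreeGroup.Generators B → FreeGroup (Fin n) :=
    Sum.elim (fun i => (bA i : FreeGroup (Fin n))) (fun j => (bB j : FreeGroup (Fin n)))
  have cA : Subgroup.closure (Set.range fun i => (bA i : FreeGroup (Fin n))) = A := by
    have h := congrArg (Subgroup.map A.subtype) (basis_closure bA)
    rw [MonoidHom.map_closure, ← Set.range_comp, ← MonoidHom.range_eq_map,
      Subgroup.range_subtype] at h
    exact h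
  have cB : Subgroup.closure (Set.range fun i => (bB i : FreeGroup (Fin n))) = B := by
    have h := congrArg (Subgroup.map B.subtype) (basis_closure bB)
    rw [MonoidHom.map_closure, ← Set.range_comp, ← MonoidHom.range_eq_map,
      Subgroup.range_subtype] at h
    exact h
  refine core s (Set.range Sum.inl) ?_ ?_ H A ?_
  · rw [Set.Sum.elim_range, Subgroup.closure_union, cA, cB]
    have h := MonoidHom.range_eq_top.2 hB.2
    rw [Monoid.Coprod.range_lift, Subgroup.range_subtype, Subgroup.range_subtype] at h
    exact h
  · intro N _ f
    let e := MulEquiv.ofBijective _ hB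
    let F : Monoid.Coprod A B →* N :=
      Monoid.Coprod.lift (bA.lift (f ∘ Sum.inl)) (bB.lift (f ∘ Sum.inr))
    refine ⟨F.comp e.symm.toMonoidHom, ?_⟩
    rintro (i | j)
    · have : e.symm (bA i : FreeGroup (Fin n)) = Monoid.Coprod.inl (bA i) := by
        rw [MulEquiv.symm_apply_eq]; simp [e]
      simp [s, this, F]
    · have : e.symm (bB j : FreeGroup (Fin n)) = Monoid.Coprod.inr (bB j) := by
        rw [MulEquiv.symm_apply_eq]; simp [e]
      simp [s, this, F]
  · rw [← Set.range_comp]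
    exact cA
end

section
/- Let A ≤ H ≤ F_n be subgroups of a finitely generated free group with A a free factor of F_n. Then A is a free factor of H, and in particular rank(A) ≤ rank(H) when H is finitely generated. -/
section Aux

theorem FGB_ind {ι G : Type} [Group G] (b : FreeGroupBasis ι G) (P : G → Prop) (h1 : P 1)
    (hb : ∀ i, P (b i)) (hmul : ∀ x y, P x → P y → P (x * y)) (hinv : ∀ x, P x → P x⁻¹) (g : G) :
    P g := by
  have : ∀ w : FreeGroup ι, P (b.repr.symm w) := by
    intro w
    induction w using FreeGroup.induction_on with
    | C1 => simpa using h1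
    | of i => exact hb i
    | inv_of i _ => rw [map_inv]; exact hinv _ (hb i)
    | mul x y hx hy => rw [map_mul]; exact hmul _ _ hx hy
  simpa using this (b.repr g)

/-- Existence of a Schreier transversal, in the form of an induction principle. -/
theorem exists_transversal_s3 {ι G : Type} [Group G] (b : FreeGroupBasis ι G) (H : Subgroup G) :
    ∃ t : G ⧸ H → G, t ((1 : G) : G ⧸ H) = 1 ∧ (∀ y, ((t y : G) : G ⧸ H) = y) ∧
      ∀ P : G ⧸ H → Prop, P ((1 : G) : G ⧸ H) →
        (∀ x y, t (b x • y) = b x * t y → (P y ↔ P (b x • y))) → ∀ y, P y := by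
  classical
  let y0 : G ⧸ H := ((1 : G) : G ⧸ H)
  let ev : List (ι × Bool) → G ⧸ H := fun L => b.repr.symm (FreeGroup.mk L) • y0
  have hex : ∀ y : G ⧸ H, ∃ n, ∃ L : List (ι × Bool), L.length = n ∧ ev L = y := by
    intro y
    induction y using QuotientGroup.induction_on with
    | H g =>
      refine ⟨_, (b.repr g).toWord, rfl, ?_⟩
      simp only [ev, FreeGroup.mk_toWord, y0]
      simp
  let h : G ⧸ H → ℕ := fun y => Nat.find (hex y)
  have hpar : ∀ y : G ⧸ H, ∃ q : G × (G ⧸ H), y ≠ y0 →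
      q.1 • q.2 = y ∧ h q.2 < h y ∧ ∃ x, q.1 = b x ∨ q.1 = (b x)⁻¹ := by
    intro y
    obtain ⟨L, hL, hLy⟩ := Nat.find_spec (hex y)
    match L, hL, hLy with
    | [], hL, hLy =>
      refine ⟨(1, y0), fun hne => (hne ?_).elim⟩
      rw [← hLy]
      change b.repr.symm 1 • y0 = y0
      rw [map_one, one_smul]
    | (x, e) :: L, hL, hLy =>
      refine ⟨(b.repr.symm (FreeGroup.mk [(x, e)]), ev L), fun _ => ⟨?_, ?_, x, ?_⟩⟩
      · rw [← hLy]
        simp only [ev]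
        rw [← mul_smul, ← map_mul, FreeGroup.mul_mk]
        rfl
      · have : h (ev L) ≤ L.length := Nat.find_min' _ ⟨L, rfl, rfl⟩
        have h2 : h y = L.length + 1 := hL.symm
        change h (ev L) < h y
        omega
      · cases e
        · right
          change _ = (b.repr.symm (FreeGroup.of x))⁻¹
          rw [← map_inv]; rfl
        · left; rfl
  choose q hq using hpar
  have wf : WellFounded (fun y z : G ⧸ H => h y < h z) := (measure h).wf
  let t : G ⧸ H → G := wf.fix (fun y rec =>
    if hy : y = y0 then 1 else (q y).1 * rec (q y).2 (hq y hy).2.1)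
  have ht : ∀ y, t y = if y = y0 then 1 else (q y).1 * t (q y).2 := by
    intro y
    have := wf.fix_eq (fun y (rec : ∀ z, h z < h y → G) =>
      if hy : y = y0 then 1 else (q y).1 * rec (q y).2 (hq y hy).2.1) y
    simp only [dite_eq_ite] at this
    exact this
  have ht0 : t y0 = 1 := by rw [ht, if_pos rfl]
  refine ⟨t, ht0, ?_, ?_⟩
  · intro y
    induction y using wf.induction with
    | _ y ih =>
      by_cases hy : y = y0
      · rw [hy, ht0]
      · rw [ht, if_neg hy]
        have := ih _ (hq y hy).2.1
        change (q y).1 • ((t (q y).2 : G) : G ⧸ H) = y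
        rw [this, (hq y hy).1]
  · intro P hP0 hP y
    induction y using wf.induction with
    | _ y ih =>
      by_cases hy : y = y0
      · rw [hy]; exact hP0
      · have ih' := ih _ (hq y hy).2.1
        obtain ⟨h1, h2, x, h3⟩ := hq y hy
        have hty := ht y
        rw [if_neg hy] at hty
        rcases h3 with h3 | h3
        · rw [h3] at h1 hty
          rw [← h1]
          refine (hP x _ ?_).1 ih'
          rw [h1, hty]
        · rw [h3] at h1 hty
          have h4 : (q y).2 = b x • y := by
            conv_rhs => rw [← h1, smul_inv_smul]
          refine (hP x y ?_).2 (h4 ▸ ih')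
          rw [← h4, hty, mul_inv_cancel_left]

theorem ofUniqueLift_apply {G : Type} [Group G] (X : Type) (of : X → G)
    (h : ∀ {H : Type} [Group H] (f : X → H), ∃! F : G →* H, ∀ a, F (of a) = f a) (x : X) :
    FreeGroupBasis.ofUniqueLift X of h x = of x := by
  change FreeGroup.lift of (FreeGroup.of x) = of x
  simp

/-- Nielsen-Schreier, with a basis containing the ambient basis elements lying in `H`. -/
theorem exists_basis {ι G : Type} [Group G] (b : FreeGroupBasis ι G) (H : Subgroup G) :
    ∃ (S : Type) (c : FreeGroupBasis S H), ∀ x, b x ∈ H → ∃ s, (c s : G) = b x := by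
  classical
  obtain ⟨t, t0, ht, hind⟩ := exists_transversal_s3 b H
  let y0 : G ⧸ H := ((1 : G) : G ⧸ H)
  have t0' : t y0 = 1 := t0
  let γ : G → G ⧸ H → G := fun g y => (t (g • y))⁻¹ * (g * t y)
  have hγ : ∀ g y, γ g y ∈ H := by
    intro g y
    apply QuotientGroup.eq.1
    rw [ht]
    change g • y = g • ((t y : G) : G ⧸ H)
    rw [ht]
  have hfix : ∀ g ∈ H, g • y0 = y0 := by
    intro g hg
    change ((g * 1 : G) : G ⧸ H) = ((1 : G) : G ⧸ H)
    rw [mul_one]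
    exact (QuotientGroup.eq.2 (by simpa using hg)).symm
  have hγH : ∀ g ∈ H, γ g y0 = g := by
    intro g hg
    simp only [γ]
    rw [hfix g hg, t0']; simp
  let S : Type := {p : ι × (G ⧸ H) // γ (b p.1) p.2 ≠ 1}
  let of : S → H := fun s => ⟨γ (b s.1.1) s.1.2, hγ _ _⟩
  -- generation
  have hgen : ∀ K : Subgroup H, (∀ s, of s ∈ K) → K = ⊤ := by
    intro K hK
    have key : ∀ g y, (⟨γ g y, hγ g y⟩ : H) ∈ K := by
      intro g
      induction g using FGB_ind b with
      | h1 =>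
        intro y
        convert K.one_mem
        simp [γ]
      | hb x =>
        intro y
        by_cases h : γ (b x) y = 1
        · have : (⟨γ (b x) y, hγ _ _⟩ : H) = 1 := Subtype.ext h
          rw [this]; exact K.one_mem
        · exact hK ⟨(x, y), h⟩
      | hmul g k hg hk =>
        intro y
        convert K.mul_mem (hg (k • y)) (hk y)
        simp [γ, mul_smul, mul_assoc]
      | hinv g hg =>
        intro y
        convert K.inv_mem (hg (g⁻¹ • y))
        simp [γ, mul_assoc]
    rw [eq_top_iff]
    rintro ⟨g, hg⟩ -
    have := key g y0
    simp only [hγH g hg] at this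
    exact this
  refine ⟨S, FreeGroupBasis.ofUniqueLift S of ?_, ?_⟩
  · intro X _ f
    let f' : ι → G ⧸ H → X := fun x y => if h : γ (b x) y ≠ 1 then f ⟨(x, y), h⟩ else 1
    let F : G →* (G ⧸ H → X) ⋊[mulAutArrow] G :=
      b.lift (fun x => ⟨fun y => f' x ((b x)⁻¹ • y), b x⟩)
    have hFb : ∀ x, F (b x) = ⟨fun y => f' x ((b x)⁻¹ • y), b x⟩ := by
      intro x
      exact congrFun (b.lift.symm_apply_apply _) x
    have hFr : ∀ g, (F g).right = g := by
      have : SemidirectProduct.rightHom.comp F = MonoidHom.id _ := by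
        apply b.ext_hom
        intro x
        simp [hFb]
      exact fun g => DFunLike.congr_fun this g
    let c : G → G ⧸ H → X := fun g y => (F g).left (g • y)
    have hc : ∀ g k y, c (g * k) y = c g (k • y) * c k y := by
      intro g k y
      simp only [c, map_mul, SemidirectProduct.mul_left, Pi.mul_apply, hFr]
      rw [mul_smul]
      congr 1
      change (F k).left (g⁻¹ • g • k • y) = _
      rw [inv_smul_smul]
    have hcb : ∀ x y, c (b x) y = f' x y := by
      intro x y
      simp [c, hFb]
    have hc1 : ∀ y, c 1 y = 1 := by
      intro y; simp [c]
    have hct : ∀ y, c (t y) y0 = 1 := by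
      apply hind
      · rw [t0]; exact hc1 _
      · intro x y hxy
        have e : t y • y0 = y := by
          conv_rhs => rw [← ht y]
          change ((t y * 1 : G) : G ⧸ H) = _
          rw [mul_one]
        rw [hxy, hc, e, hcb]
        have : f' x y = 1 := by
          simp only [f']
          rw [dif_neg]
          simp [γ, hxy]
        rw [this, one_mul]
    let E : H →* X :=
      { toFun := fun g => c g y0
        map_one' := hc1 _
        map_mul' := by
          intro g k
          rw [Subgroup.coe_mul, hc, hfix k k.2] }
    have hE : ∀ s, E (of s) = f s := by
      rintro ⟨⟨x, y⟩, hs⟩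
      have e : t y • y0 = y := by
        conv_rhs => rw [← ht y]
        change ((t y * 1 : G) : G ⧸ H) = _
        rw [mul_one]
      have e1 : c (b x * t y) y0 = f' x y := by rw [hc, hct, e, hcb, mul_one]
      have e2 : c (t (b x • y) * γ (b x) y) y0 = c (γ (b x) y) y0 := by
        rw [hc, hfix _ (hγ _ _), hct, one_mul]
      have e3 : t (b x • y) * γ (b x) y = b x * t y := by simp [γ]
      change c (γ (b x) y) y0 = _
      rw [← e2, e3, e1]
      exact dif_pos hs
    refine ⟨E, hE, ?_⟩
    intro E' hE'
    have := hgen (MonoidHom.eqLocus E' E) (fun s => (hE' s).trans (hE s).symm)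
    ext g
    have hg : g ∈ MonoidHom.eqLocus E' E := by rw [this]; trivial
    exact hg
  · intro x hx
    have h1 : γ (b x) y0 = b x := hγH _ hx
    refine ⟨⟨(x, y0), ?_⟩, ?_⟩
    · rw [h1]
      intro h
      have h2 : b.repr (b x) = 1 := by rw [h, map_one]
      rw [FreeGroupBasis.repr_apply_coe] at h2
      exact FreeGroup.of_ne_one x h2
    · exact (congrArg Subtype.val (ofUniqueLift_apply S of _ _)).trans h1

theorem freeFactor_closure {S G : Type} [Group G] (c : FreeGroupBasis S G) (S' : Set S) :
    IsFreeFactor (Subgroup.closure (c '' S')) := by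
  classical
  refine ⟨Subgroup.closure (c '' S'ᶜ), ?_, ?_⟩
  · let φ : G →* Monoid.Coprod (Subgroup.closure (c '' S')) (Subgroup.closure (c '' S'ᶜ)) :=
      c.lift (fun s => if h : s ∈ S' then
        Monoid.Coprod.inl ⟨c s, Subgroup.subset_closure ⟨s, h, rfl⟩⟩ else
        Monoid.Coprod.inr ⟨c s, Subgroup.subset_closure ⟨s, h, rfl⟩⟩)
    have hφ : ∀ s, φ (c s) = if h : s ∈ S' then
        Monoid.Coprod.inl ⟨c s, Subgroup.subset_closure ⟨s, h, rfl⟩⟩ else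
        Monoid.Coprod.inr ⟨c s, Subgroup.subset_closure ⟨s, h, rfl⟩⟩ :=
      fun s => congrFun (c.lift.symm_apply_apply _) s
    have h1 : ∀ g (hg : g ∈ Subgroup.closure (c '' S')), φ g = Monoid.Coprod.inl ⟨g, hg⟩ := by
      intro g hg
      induction hg using Subgroup.closure_induction with
      | mem x hx =>
        obtain ⟨s, hs, rfl⟩ := hx
        rw [hφ, dif_pos hs]
      | one => rw [map_one]; exact (map_one _).symm
      | mul x y hx hy ihx ihy => rw [map_mul, ihx, ihy, ← map_mul]; rfl
      | inv x hx ihx => rw [map_inv, ihx, ← map_inv]; rfl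
    have h2 : ∀ g (hg : g ∈ Subgroup.closure (c '' S'ᶜ)), φ g = Monoid.Coprod.inr ⟨g, hg⟩ := by
      intro g hg
      induction hg using Subgroup.closure_induction with
      | mem x hx =>
        obtain ⟨s, hs, rfl⟩ := hx
        rw [hφ, dif_neg hs]
      | one => rw [map_one]; exact (map_one _).symm
      | mul x y hx hy ihx ihy => rw [map_mul, ihx, ihy, ← map_mul]; rfl
      | inv x hx ihx => rw [map_inv, ihx, ← map_inv]; rfl
    have : φ.comp (Monoid.Coprod.lift (Subgroup.subtype _) (Subgroup.subtype _)) =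
        MonoidHom.id _ := by
      apply Monoid.Coprod.hom_ext
      · ext ⟨g, hg⟩
        simp [h1 g hg]
      · ext ⟨g, hg⟩
        simp [h2 g hg]
    exact Function.LeftInverse.injective (g := φ) (fun x => DFunLike.congr_fun this x)
  · intro g
    induction g using FGB_ind c with
    | h1 => exact ⟨1, map_one _⟩
    | hb s =>
      by_cases h : s ∈ S'
      · exact ⟨Monoid.Coprod.inl ⟨c s, Subgroup.subset_closure ⟨s, h, rfl⟩⟩, by simp⟩
      · exact ⟨Monoid.Coprod.inr ⟨c s, Subgroup.subset_closure ⟨s, h, rfl⟩⟩, by simp⟩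
    | hmul x y hx hy =>
      obtain ⟨u, rfl⟩ := hx
      obtain ⟨v, rfl⟩ := hy
      exact ⟨u * v, map_mul _ _ _⟩
    | hinv x hx =>
      obtain ⟨u, rfl⟩ := hx
      exact ⟨u⁻¹, map_inv _ _⟩

theorem exists_basis_of_freeFactor {G : Type} [Group G] [IsFreeGroup G] (A : Subgroup G)
    (hA : IsFreeFactor A) :
    ∃ (ι : Type) (b : FreeGroupBasis ι G) (I : Set ι), Subgroup.closure (b '' I) = A := by
  obtain ⟨B, hB⟩ := hA
  let e := MulEquiv.ofBijective _ hB
  let a := IsFreeGroup.basis A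
  let b := IsFreeGroup.basis B
  let of : IsFreeGroup.Generators A ⊕ IsFreeGroup.Generators B → G :=
    Sum.elim (fun x => (a x : G)) (fun x => (b x : G))
  have hea : ∀ x : A, e (Monoid.Coprod.inl x) = x := fun x => by simp [e]
  have heb : ∀ x : B, e (Monoid.Coprod.inr x) = x := fun x => by simp [e]
  have h : ∀ {K : Type} [Group K] (f : IsFreeGroup.Generators A ⊕ IsFreeGroup.Generators B → K),
      ∃! F : G →* K, ∀ x, F (of x) = f x := by
    intro K _ f
    have ha : ∀ x, a.lift (fun x => f (Sum.inl x)) (a x) = f (Sum.inl x) :=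
      fun x => congrFun (a.lift.symm_apply_apply _) x
    have hb : ∀ x, b.lift (fun x => f (Sum.inr x)) (b x) = f (Sum.inr x) :=
      fun x => congrFun (b.lift.symm_apply_apply _) x
    refine ⟨(Monoid.Coprod.lift (a.lift (fun x => f (Sum.inl x)))
      (b.lift (fun x => f (Sum.inr x)))).comp e.symm.toMonoidHom, ?_, ?_⟩
    · rintro (x | x)
      · change Monoid.Coprod.lift _ _ (e.symm (a x : G)) = _
        rw [← hea, MulEquiv.symm_apply_apply, Monoid.Coprod.lift_apply_inl, ha]
      · change Monoid.Coprod.lift _ _ (e.symm (b x : G)) = _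
        rw [← heb, MulEquiv.symm_apply_apply, Monoid.Coprod.lift_apply_inr, hb]
    · intro F hF
      have : F.comp e.toMonoidHom = Monoid.Coprod.lift (a.lift (fun x => f (Sum.inl x)))
          (b.lift (fun x => f (Sum.inr x))) := by
        apply Monoid.Coprod.hom_ext
        · apply a.ext_hom
          intro x
          change F (e (Monoid.Coprod.inl (a x))) =
            Monoid.Coprod.lift (a.lift (fun x => f (Sum.inl x)))
              (b.lift (fun x => f (Sum.inr x))) (Monoid.Coprod.inl (a x))
          rw [hea, Monoid.Coprod.lift_apply_inl, ha]
          exact hF (Sum.inl x)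
        · apply b.ext_hom
          intro x
          change F (e (Monoid.Coprod.inr (b x))) =
            Monoid.Coprod.lift (a.lift (fun x => f (Sum.inl x)))
              (b.lift (fun x => f (Sum.inr x))) (Monoid.Coprod.inr (b x))
          rw [heb, Monoid.Coprod.lift_apply_inr, hb]
          exact hF (Sum.inr x)
      rw [← this]
      ext g
      simp
  refine ⟨_, FreeGroupBasis.ofUniqueLift _ of h, Set.range Sum.inl, ?_⟩
  apply le_antisymm
  · rw [Subgroup.closure_le]
    rintro _ ⟨_, ⟨x, rfl⟩, rfl⟩
    rw [ofUniqueLift_apply]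
    exact (a x).2
  · intro g hg
    have : ∀ g : A, (g : G) ∈ Subgroup.closure
        (FreeGroupBasis.ofUniqueLift _ of h '' Set.range Sum.inl) := by
      intro g
      induction g using FGB_ind a with
      | h1 => exact Subgroup.one_mem _
      | hb x =>
        apply Subgroup.subset_closure
        exact ⟨Sum.inl x, ⟨x, rfl⟩, by rw [ofUniqueLift_apply]; rfl⟩
      | hmul x y hx hy => exact Subgroup.mul_mem _ hx hy
      | hinv x hx => exact Subgroup.inv_mem _ hx
    exact this ⟨g, hg⟩

theorem rank_le_of_surj {r s : ℕ} (f : FreeGroup (Fin s) →* FreeGroup (Fin r))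
    (hf : Function.Surjective f) : r ≤ s := by
  let M := Multiplicative (ZMod 2)
  let Φ : (Fin r → M) → (Fin s → M) := fun u =>
    FreeGroup.lift.symm ((FreeGroup.lift u).comp f)
  have hΦ : Function.Injective Φ := by
    intro u v huv
    have h1 := FreeGroup.lift.symm.injective huv
    exact FreeGroup.lift.injective ((MonoidHom.cancel_right hf).1 h1)
  have h2 := Nat.card_le_card_of_injective Φ hΦ
  have hM : Nat.card M = 2 := by simp [M]
  rw [Nat.card_fun, Nat.card_fun, hM] at h2
  simp only [Nat.card_eq_fintype_card, Fintype.card_fin] at h2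
  exact (Nat.pow_le_pow_iff_right (by norm_num)).1 h2

end Aux

theorem statement3 {n : ℕ} (A H : Subgroup (FreeGroup (Fin n)))
    (hAH : A ≤ H) (hA : IsFreeFactor A) :
    IsFreeFactorIn A H ∧ (H.FG → ∀ r s : ℕ, HasRank A r → HasRank H s → r ≤ s) := by
  have main : IsFreeFactor (A.subgroupOf H) := by
    obtain ⟨ι, b, I, hI⟩ := exists_basis_of_freeFactor A hA
    obtain ⟨S, c, hc⟩ := exists_basis b H
    have : A.subgroupOf H = Subgroup.closure (c '' {s | (c s : FreeGroup (Fin n)) ∈ b '' I}) := by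
      apply Subgroup.map_injective H.subtype_injective
      rw [Subgroup.map_subgroupOf_eq_of_le hAH, MonoidHom.map_closure, ← hI]
      congr 1
      ext g
      constructor
      · rintro ⟨x, hx, rfl⟩
        have : b x ∈ H := hAH (hI ▸ Subgroup.subset_closure ⟨x, hx, rfl⟩)
        obtain ⟨s, hs⟩ := hc x this
        exact ⟨c s, ⟨s, ⟨x, hx, hs.symm⟩, rfl⟩, hs⟩
      · rintro ⟨_, ⟨s, hs, rfl⟩, rfl⟩
        exact hs
    rw [this]
    exact freeFactor_closure c _
  refine ⟨⟨hAH, main⟩, ?_⟩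
  rintro - r s ⟨eA⟩ ⟨eH⟩
  obtain ⟨B, hB⟩ := main
  let e := MulEquiv.ofBijective _ hB
  let ρ : H →* A.subgroupOf H := (Monoid.Coprod.lift (MonoidHom.id _) 1).comp e.symm.toMonoidHom
  have hρ : Function.Surjective ρ := by
    intro x
    refine ⟨e (Monoid.Coprod.inl x), ?_⟩
    simp [ρ]
  let e2 : A.subgroupOf H ≃* FreeGroup (Fin r) := (Subgroup.subgroupOfEquivOfLe hAH).trans eA.symm
  exact rank_le_of_surj (e2.toMonoidHom.comp (ρ.comp eH.toMonoidHom))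
    (e2.surjective.comp (hρ.comp eH.surjective))
end

section
/- If A and B are free factors of a finitely generated free group F_n, then A ∩ B is a free factor of F_n. -/
namespace FFI

/-- existence part of the universal property -/
theorem exists_hom {G X K : Type} [Group G] [Group K] (b : X → G) (hb : IsFreeBasis b)
    (c : X → K) : ∃ Φ : G →* K, ∀ x, Φ (b x) = c x := by
  let e := MulEquiv.ofBijective (FreeGroup.lift b) hb
  refine ⟨(FreeGroup.lift c).comp e.symm.toMonoidHom, fun x => ?_⟩
  have : e.symm (b x) = FreeGroup.of x := by
    rw [MulEquiv.symm_apply_eq]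
    exact (FreeGroup.lift_apply_of (f := b) (x := x)).symm
  simp [this]

theorem closure_eq_top {G X : Type} [Group G] (b : X → G) (hb : IsFreeBasis b) :
    Subgroup.closure (Set.range b) = ⊤ := by
  rw [← FreeGroup.range_lift_eq_closure]
  exact MonoidHom.range_eq_top.2 hb.2

/-- partial Schreier transversals -/
structure Good {G X : Type} [Group G] (b : X → G) (H : Subgroup G) (T : Set G) : Prop where
  one : (1 : G) ∈ T
  inj : ∀ s ∈ T, ∀ t ∈ T, (s : G ⧸ H) = t → s = t
  ind : ∀ P : G → Prop, P 1 → (∀ t ∈ T, ∀ x, P t → b x * t ∈ T → P (b x * t)) →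
    (∀ t ∈ T, ∀ x, P t → (b x)⁻¹ * t ∈ T → P ((b x)⁻¹ * t)) → ∀ t ∈ T, P t

theorem good_one {G X : Type} [Group G] (b : X → G) (H : Subgroup G) : Good b H {1} := by
  refine ⟨rfl, ?_, ?_⟩
  · rintro s rfl t rfl _; rfl
  · rintro P h1 _ _ t rfl; exact h1

theorem good_insert {G X : Type} [Group G] {b : X → G} {H : Subgroup G} {T : Set G}
    (hT : Good b H T) (t : G) (ht : t ∈ T) (x : X) (g : G) (hg : g = b x * t ∨ g = (b x)⁻¹ * t)
    (hn : ∀ s ∈ T, (s : G ⧸ H) ≠ g) : Good b H (insert g T) := by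
  refine ⟨Or.inr hT.one, ?_, ?_⟩
  · rintro s (rfl | hs) u (rfl | hu) h
    · rfl
    · exact absurd h.symm (hn u hu)
    · exact absurd h (hn s hs)
    · exact hT.inj s hs u hu h
  · intro P h1 h2 h3
    have key : ∀ t ∈ T, P t := hT.ind P h1
      (fun t ht x hp hm => h2 t (Or.inr ht) x hp (Or.inr hm))
      (fun t ht x hp hm => h3 t (Or.inr ht) x hp (Or.inr hm))
    rintro s (rfl | hs)
    · rcases hg with rfl | rfl
      · exact h2 t (Or.inr ht) x (key t ht) (Or.inl rfl)
      · exact h3 t (Or.inr ht) x (key t ht) (Or.inl rfl)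
    · exact key s hs

theorem exists_good {G X : Type} [Group G] (b : X → G) (H : Subgroup G) (Y : Set X) (T₀ : Set G)
    (h₀ : Good b H T₀) (h₀' : T₀ ⊆ Subgroup.closure (b '' Y)) :
    ∃ T, T₀ ⊆ T ∧ Good b H T ∧ T ⊆ Subgroup.closure (b '' Y) ∧
      ∀ a ∈ Subgroup.closure (b '' Y), ∃ t ∈ T, (t : G ⧸ H) = a := by
  obtain ⟨T, hT₀, hT⟩ := zorn_subset_nonempty
    {T : Set G | Good b H T ∧ T ⊆ Subgroup.closure (b '' Y)} (by
      intro c hc hch hne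
      refine ⟨⋃₀ c, ⟨⟨?_, ?_, ?_⟩, ?_⟩, fun s hs => Set.subset_sUnion_of_mem hs⟩
      · obtain ⟨s, hs⟩ := hne
        exact ⟨s, hs, (hc hs).1.one⟩
      · rintro s ⟨u, hu, hsu⟩ t ⟨v, hv, htv⟩ h
        rcases hch.total hu hv with huv | huv
        · exact (hc hv).1.inj s (huv hsu) t htv h
        · exact (hc hu).1.inj s hsu t (huv htv) h
      · rintro P h1 h2 h3 t ⟨v, hv, htv⟩
        exact (hc hv).1.ind P h1
          (fun t ht x hp hm => h2 t ⟨v, hv, ht⟩ x hp ⟨v, hv, hm⟩)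
          (fun t ht x hp hm => h3 t ⟨v, hv, ht⟩ x hp ⟨v, hv, hm⟩) t htv
      · exact Set.sUnion_subset fun s hs => (hc hs).2) T₀ ⟨h₀, h₀'⟩
  have hg := hT.prop.1
  have hs := hT.prop.2
  refine ⟨T, hT₀, hg, hs, ?_⟩
  have step : ∀ t ∈ T, ∀ x ∈ Y, ∀ g : G, (g = b x * t ∨ g = (b x)⁻¹ * t) →
      ∃ s ∈ T, (s : G ⧸ H) = g := by
    intro t ht x hx g hgx
    by_contra hcon
    push Not at hcon
    have h1 := good_insert hg t ht x g hgx hcon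
    have hbx : b x ∈ Subgroup.closure (b '' Y) := Subgroup.subset_closure ⟨x, hx, rfl⟩
    have hgm : g ∈ Subgroup.closure (b '' Y) := by
      rcases hgx with rfl | rfl
      · exact mul_mem hbx (hs ht)
      · exact mul_mem (inv_mem hbx) (hs ht)
    have h2 : insert g T ⊆ T := hT.le_of_ge
      ⟨h1, Set.insert_subset hgm hs⟩ (Set.subset_insert g T)
    exact hcon g (h2 (Or.inl rfl)) rfl
  intro a ha
  induction ha using Subgroup.closure_induction_left with
  | one => exact ⟨1, hg.one, rfl⟩
  | mul_left x hx y hy ih =>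
    obtain ⟨x, hxY, rfl⟩ := hx
    obtain ⟨t, ht, hty⟩ := ih
    obtain ⟨s, hs, hst⟩ := step t ht x hxY _ (Or.inl rfl)
    refine ⟨s, hs, hst.trans ?_⟩
    exact congrArg (fun q : G ⧸ H => b x • q) hty
  | inv_mul_cancel x hx y hy ih =>
    obtain ⟨x, hxY, rfl⟩ := hx
    obtain ⟨t, ht, hty⟩ := ih
    obtain ⟨s, hs, hst⟩ := step t ht x hxY _ (Or.inr rfl)
    refine ⟨s, hs, hst.trans ?_⟩
    exact congrArg (fun q : G ⧸ H => (b x)⁻¹ • q) hty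

/-- Schreier transversal adapted to `Y`. -/
theorem exists_transversal {G X : Type} [Group G] (b : X → G) (hb : IsFreeBasis b)
    (H : Subgroup G) (Y : Set X) :
    ∃ (T : Set G) (t : G ⧸ H → G), Good b H T ∧ (∀ q, t q ∈ T) ∧ (∀ q, (t q : G ⧸ H) = q) ∧
      (∀ s ∈ T, t s = s) ∧
      ∀ a ∈ Subgroup.closure (b '' Y), t a ∈ Subgroup.closure (b '' Y) := by
  obtain ⟨T₁, -, h1, h2, h3⟩ := exists_good b H Y {1} (good_one b H)
    (by rintro _ rfl; exact one_mem _)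
  have htop : Subgroup.closure (b '' Set.univ) = ⊤ := by
    rw [Set.image_univ]; exact closure_eq_top b hb
  obtain ⟨T, hTT, h4, -, h5⟩ := exists_good b H Set.univ T₁ h1 (by rw [htop]; simp)
  have h6 : ∀ q : G ⧸ H, ∃ t ∈ T, (t : G ⧸ H) = q := by
    intro q
    induction q using QuotientGroup.induction_on with
    | H z => exact h5 z (by rw [htop]; trivial)
  choose t ht htq using h6
  refine ⟨T, t, h4, ht, htq, fun s hs => h4.inj _ (ht _) _ hs (htq _), ?_⟩
  intro a ha
  obtain ⟨s, hs, hsa⟩ := h3 a ha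
  have : t a = s := h4.inj _ (ht _) _ (hTT hs) ((htq _).trans hsa.symm)
  rw [this]; exact h2 hs

/-- permutation of `Q × K` attached to a generator -/
def stepPerm {G K Q : Type} [Group G] [Group K] [MulAction G Q] (g : G) (f : Q → K) :
    Equiv.Perm (Q × K) where
  toFun p := (g • p.1, f p.1 * p.2)
  invFun p := (g⁻¹ • p.1, (f (g⁻¹ • p.1))⁻¹ * p.2)
  left_inv p := by simp
  right_inv p := by simp

theorem main {G X : Type} [Group G] (b : X → G) (hb : IsFreeBasis b)
    (H : Subgroup G) (Y : Set X) :
    ∃ (ι κ : Type) (v : ι ⊕ κ → H), IsFreeBasis v ∧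
      Subgroup.closure (Set.range (v ∘ Sum.inl)) = (Subgroup.closure (b '' Y)).subgroupOf H := by
  classical
  obtain ⟨T, t, hT, ht, htq, hts, hta⟩ := exists_transversal b hb H Y
  have ht1 : t ((1 : G) : G ⧸ H) = 1 := hts 1 hT.one
  have hsm : ∀ (g : G) (q : G ⧸ H), ((g * t q : G) : G ⧸ H) = g • q := by
    intro g q
    exact congrArg (fun q : G ⧸ H => g • q) (htq q)
  let h' : G → G ⧸ H → G := fun g q => (t (g • q))⁻¹ * (g * t q)
  have hmem : ∀ g q, h' g q ∈ H := by
    intro g q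
    apply QuotientGroup.eq.1
    rw [htq, hsm]
  let h : G → G ⧸ H → H := fun g q => ⟨h' g q, hmem g q⟩
  have hmul : ∀ g g' q, h (g * g') q = h g (g' • q) * h g' q := by
    intro g g' q
    apply Subtype.ext
    simp [h, h', mul_smul, mul_assoc]
  have hinv : ∀ g q, h g⁻¹ q = (h g (g⁻¹ • q))⁻¹ := by
    intro g q
    apply Subtype.ext
    simp [h, h', mul_assoc]
  have hH : ∀ g : H, h g ((1 : G) : G ⧸ H) = g := by
    intro g
    apply Subtype.ext
    have : (g : G) • ((1 : G) : G ⧸ H) = ((1 : G) : G ⧸ H) := by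
      have := QuotientGroup.eq (s := H) (a := (g : G) * 1) (b := 1)
      exact this.2 (by simp)
    simp [h, h', this, ht1]
  let E := {p : (G ⧸ H) × X // h (b p.2) p.1 ≠ 1}
  let v : E → H := fun p => h (b p.1.2) p.1.1
  let O : Set (G ⧸ H) := {q | ∃ a ∈ Subgroup.closure (b '' Y), (a : G ⧸ H) = q}
  let pr : E → Prop := fun p => p.1.1 ∈ O ∧ p.1.2 ∈ Y
  -- surjectivity
  have hsurj : Subgroup.closure (Set.range v) = ⊤ := by
    have key : ∀ g ∈ Subgroup.closure (Set.range b), ∀ q,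
        h g q ∈ Subgroup.closure (Set.range v) := by
      intro g hg
      induction hg using Subgroup.closure_induction with
      | mem g hg =>
        obtain ⟨x, rfl⟩ := hg
        intro q
        by_cases h1 : h (b x) q = 1
        · rw [h1]; exact one_mem _
        · exact Subgroup.subset_closure ⟨⟨(q, x), h1⟩, rfl⟩
      | one =>
        intro q
        have : h 1 q = 1 := by apply Subtype.ext; simp [h, h']
        rw [this]; exact one_mem _
      | mul g g' _ _ ih ih' => intro q; rw [hmul]; exact mul_mem (ih _) (ih' _)
      | inv g _ ih => intro q; rw [hinv]; exact inv_mem (ih _)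
    rw [eq_top_iff]
    intro g _
    rw [← hH g]
    exact key g (by rw [closure_eq_top b hb]; trivial) _
  have hA : Subgroup.closure (v '' {p | pr p}) = (Subgroup.closure (b '' Y)).subgroupOf H := by
    have hO : ∀ g ∈ Subgroup.closure (b '' Y), ∀ q ∈ O, g • q ∈ O := by
      rintro g hg q ⟨a, ha, rfl⟩
      exact ⟨g * a, mul_mem hg ha, rfl⟩
    have hOt : ∀ q ∈ O, t q ∈ Subgroup.closure (b '' Y) := by
      rintro q ⟨a, ha, rfl⟩; exact hta a ha
    apply le_antisymm
    · rw [Subgroup.closure_le]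
      rintro _ ⟨p, ⟨hp1, hp2⟩, rfl⟩
      have hbx : b p.1.2 ∈ Subgroup.closure (b '' Y) := Subgroup.subset_closure ⟨_, hp2, rfl⟩
      exact mul_mem (inv_mem (hOt _ (hO _ hbx _ hp1))) (mul_mem hbx (hOt _ hp1))
    · have key : ∀ g ∈ Subgroup.closure (b '' Y), ∀ q ∈ O,
          h g q ∈ Subgroup.closure (v '' {p | pr p}) := by
        intro g hg
        induction hg using Subgroup.closure_induction with
        | mem g hg =>
          obtain ⟨x, hx, rfl⟩ := hg
          intro q hq
          by_cases h1 : h (b x) q = 1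
          · rw [h1]; exact one_mem _
          · exact Subgroup.subset_closure ⟨⟨(q, x), h1⟩, ⟨hq, hx⟩, rfl⟩
        | one =>
          intro q _
          have : h 1 q = 1 := by apply Subtype.ext; simp [h, h']
          rw [this]; exact one_mem _
        | mul g g' hg hg' ih ih' =>
          intro q hq; rw [hmul]; exact mul_mem (ih _ (hO _ hg' _ hq)) (ih' _ hq)
        | inv g hg ih =>
          intro q hq; rw [hinv]; exact inv_mem (ih _ (hO _ (inv_mem hg) _ hq))
      intro g hg
      rw [← hH g]
      exact key g hg _ ⟨1, one_mem _, rfl⟩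
  -- injectivity
  have hinj : Function.Injective (FreeGroup.lift v) := by
    let f : X → G ⧸ H → FreeGroup E := fun x q =>
      if h1 : h (b x) q ≠ 1 then FreeGroup.of ⟨(q, x), h1⟩ else 1
    obtain ⟨Φ, hΦ⟩ := exists_hom b hb (fun x => stepPerm (b x) (f x))
    have htop : ∀ g, g ∈ Subgroup.closure (Set.range b) := by
      intro g; rw [closure_eq_top b hb]; trivial
    have hΦ' : ∀ x q k, Φ (b x) (q, k) = (b x • q, f x q * k) := by
      intro x q k; rw [hΦ]; rfl
    -- equivariance
    have hfst : ∀ g p, (Φ g p).1 = g • p.1 := by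
      intro g
      induction htop g using Subgroup.closure_induction with
      | mem g hg =>
        obtain ⟨x, rfl⟩ := hg
        rintro ⟨q, k⟩; rw [hΦ']
      | one => intro p; simp
      | mul g g' _ _ ih ih' => intro p; simp [ih, ih', mul_smul]
      | inv g _ ih =>
        intro p
        have := ih (Φ g⁻¹ p)
        rw [eq_inv_smul_iff, ← this]
        simp
    have hright : ∀ g q k, Φ g (q, k) = ((Φ g (q, 1)).1, (Φ g (q, 1)).2 * k) := by
      intro g
      induction htop g using Subgroup.closure_induction with
      | mem g hg =>
        obtain ⟨x, rfl⟩ := hg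
        intro q k; simp [hΦ']
      | one => intro p; simp
      | mul g g' _ _ ih ih' =>
        intro q k
        simp only [map_mul, Equiv.Perm.mul_apply]
        rw [ih' q k, ih _ (_ * k), ← Prod.mk.eta (p := Φ g' (q, 1)), ih _ (Φ g' (q, 1)).2]
        simp [mul_assoc]
      | inv g _ ih =>
        intro q k
        rw [map_inv, Equiv.Perm.inv_eq_iff_eq]
        rw [ih, ← mul_assoc]
        have h2 := ih ((Φ g)⁻¹ (q, 1)).1 ((Φ g)⁻¹ (q, 1)).2
        rw [Prod.mk.eta, ← Equiv.Perm.mul_apply, mul_inv_cancel, Equiv.Perm.one_apply] at h2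
        rw [Prod.ext_iff] at h2
        ext
        · exact h2.1
        · have h4 := h2.2
          simp only at h4 ⊢
          rw [← h4, one_mul]
    have hTΦ : ∀ s ∈ T, Φ s (((1 : G) : G ⧸ H), 1) = ((s : G ⧸ H), 1) := by
      apply hT.ind
      · simp
      · intro s hs x hp hm
        have : h (b x) (s : G ⧸ H) = 1 := by
          apply Subtype.ext
          have h2 : b x • (s : G ⧸ H) = ((b x * s : G) : G ⧸ H) := rfl
          simp only [h, h', h2, hts _ hs, hts _ hm]
          simp
        rw [map_mul, Equiv.Perm.mul_apply, hp, hΦ']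
        simp only [f, this]
        simp
      · intro s hs x hp hm
        have : h (b x) (((b x)⁻¹ * s : G) : G ⧸ H) = 1 := by
          apply Subtype.ext
          have h2 : b x • (((b x)⁻¹ * s : G) : G ⧸ H) = (s : G ⧸ H) := by
            have : b x • (((b x)⁻¹ * s : G) : G ⧸ H) = ((b x * ((b x)⁻¹ * s) : G) : G ⧸ H) := rfl
            rw [this, mul_inv_cancel_left]
          simp only [h, h', h2, hts _ hs, hts _ hm]
          simp
        rw [map_mul, Equiv.Perm.mul_apply, hp, map_inv, Equiv.Perm.inv_eq_iff_eq, hΦ']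
        simp only [f, this]
        ext
        · have : b x • (((b x)⁻¹ * s : G) : G ⧸ H) = ((b x * ((b x)⁻¹ * s) : G) : G ⧸ H) := rfl
          simp only [this, mul_inv_cancel_left]
        · simp
    have hfix : ∀ g : H, (g : G) • ((1 : G) : G ⧸ H) = ((1 : G) : G ⧸ H) := by
      intro g
      have := QuotientGroup.eq (s := H) (a := (g : G) * 1) (b := 1)
      exact this.2 (by simp)
    let ψ : H →* FreeGroup E := MonoidHom.mk' (fun g => (Φ g (((1 : G) : G ⧸ H), 1)).2) (by
      intro g g'
      simp only [Subgroup.coe_mul, map_mul, Equiv.Perm.mul_apply]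
      have h3 : Φ g' (((1 : G) : G ⧸ H), 1) =
          (((1 : G) : G ⧸ H), (Φ g' (((1 : G) : G ⧸ H), 1)).2) := by
        ext
        · rw [hfst]; exact hfix g'
        · rfl
      rw [h3, hright])
    have hψ : ψ.comp (FreeGroup.lift v) = MonoidHom.id _ := by
      ext1 e
      obtain ⟨⟨q, x⟩, he⟩ := e
      have : Φ (h' (b x) q) (((1 : G) : G ⧸ H), 1) =
          (((1 : G) : G ⧸ H), FreeGroup.of ⟨(q, x), he⟩) := by
        simp only [h', map_mul, map_inv, Equiv.Perm.mul_apply]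
        rw [Equiv.Perm.inv_eq_iff_eq, hTΦ _ (ht q), hright (t (b x • q)), hTΦ _ (ht _), htq, htq, hΦ']
        have he' : h (b x) q ≠ 1 := he
        simp [f, he']
      simp only [MonoidHom.comp_apply, FreeGroup.lift_apply_of, MonoidHom.id_apply]
      exact congrArg Prod.snd this
    intro a c hac
    have := congrArg ψ hac
    rw [← MonoidHom.comp_apply, ← MonoidHom.comp_apply, hψ] at this
    exact this
  let e : {p // pr p} ⊕ {p // ¬ pr p} ≃ E := Equiv.sumCompl pr
  refine ⟨{p // pr p}, {p // ¬ pr p}, v ∘ e, ?_, ?_⟩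
  · have : (FreeGroup.lift (v ∘ e) : FreeGroup _ →* H) =
        (FreeGroup.lift v).comp (FreeGroup.freeGroupCongr e).toMonoidHom := by
      ext1 i; simp
    unfold IsFreeBasis
    rw [this, MonoidHom.coe_comp]
    refine Function.Bijective.comp ⟨hinj, ?_⟩ (FreeGroup.freeGroupCongr e).bijective
    rw [← MonoidHom.range_eq_top, FreeGroup.range_lift_eq_closure, hsurj]
  · rw [← hA]
    congr 1
    ext y
    constructor
    · rintro ⟨i, rfl⟩
      exact ⟨i.1, i.2, by simp [e]⟩
    · rintro ⟨p, hp, rfl⟩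
      exact ⟨⟨p, hp⟩, by simp [e]⟩

/-- A subset of a basis generates a free factor. -/
theorem isFreeFactor_of_basis {G ι κ : Type} [Group G] (u : ι ⊕ κ → G) (hu : IsFreeBasis u) :
    IsFreeFactor (Subgroup.closure (Set.range (u ∘ Sum.inl))) := by
  refine ⟨Subgroup.closure (Set.range (u ∘ Sum.inr)), ?_⟩
  set A := Subgroup.closure (Set.range (u ∘ Sum.inl)) with hA
  set D := Subgroup.closure (Set.range (u ∘ Sum.inr)) with hD
  have ha : ∀ i, u (Sum.inl i) ∈ A := fun i => Subgroup.subset_closure ⟨i, rfl⟩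
  have hd : ∀ i, u (Sum.inr i) ∈ D := fun i => Subgroup.subset_closure ⟨i, rfl⟩
  obtain ⟨Φ, hΦ⟩ := exists_hom (K := Monoid.Coprod A D) u hu
    (Sum.elim (fun i => Monoid.Coprod.inl ⟨_, ha i⟩) (fun i => Monoid.Coprod.inr ⟨_, hd i⟩))
  constructor
  · have h1 : ∀ g (hg : g ∈ A), Φ g = Monoid.Coprod.inl ⟨g, hg⟩ := by
      intro g hg
      induction hg using Subgroup.closure_induction with
      | mem g hg => obtain ⟨i, rfl⟩ := hg; exact hΦ (Sum.inl i)
      | one => rw [map_one]; exact (map_one _).symm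
      | mul g g' hg hg' ih ih' =>
        rw [map_mul, ih, ih', ← map_mul]; rfl
      | inv g hg ih => rw [map_inv, ih, ← map_inv]; rfl
    have h2 : ∀ g (hg : g ∈ D), Φ g = Monoid.Coprod.inr ⟨g, hg⟩ := by
      intro g hg
      induction hg using Subgroup.closure_induction with
      | mem g hg => obtain ⟨i, rfl⟩ := hg; exact hΦ (Sum.inr i)
      | one => rw [map_one]; exact (map_one _).symm
      | mul g g' hg hg' ih ih' =>
        rw [map_mul, ih, ih', ← map_mul]; rfl
      | inv g hg ih => rw [map_inv, ih, ← map_inv]; rfl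
    have h3 : Φ.comp (Monoid.Coprod.lift A.subtype D.subtype) = MonoidHom.id _ := by
      apply Monoid.Coprod.hom_ext
      · ext1 a; simpa using h1 a a.2
      · ext1 a; simpa using h2 a a.2
    intro a c hac
    have := congrArg Φ hac
    rw [← MonoidHom.comp_apply, ← MonoidHom.comp_apply, h3] at this
    exact this
  · rw [← MonoidHom.range_eq_top, eq_top_iff, ← closure_eq_top u hu, Subgroup.closure_le]
    rintro _ ⟨i | i, rfl⟩
    · exact ⟨Monoid.Coprod.inl ⟨_, ha i⟩, by simp⟩
    · exact ⟨Monoid.Coprod.inr ⟨_, hd i⟩, by simp⟩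

/-- Bases of the two factors of a free product combine to a basis. -/
theorem basis_sum {G ι κ : Type} [Group G] (A D : Subgroup G)
    (h : Function.Bijective (Monoid.Coprod.lift A.subtype D.subtype))
    (a : ι → A) (d : κ → D) (ha : IsFreeBasis a) (hd : IsFreeBasis d) :
    IsFreeBasis (Sum.elim (fun i => (a i : G)) (fun i => (d i : G))) := by
  set u : ι ⊕ κ → G := Sum.elim (fun i => (a i : G)) (fun i => (d i : G)) with hu
  obtain ⟨α, hα⟩ := exists_hom a ha (fun i => (FreeGroup.of (Sum.inl i) : FreeGroup (ι ⊕ κ)))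
  obtain ⟨δ, hδ⟩ := exists_hom d hd (fun i => (FreeGroup.of (Sum.inr i) : FreeGroup (ι ⊕ κ)))
  let e := MulEquiv.ofBijective _ h
  have hea : ∀ x : A, e.symm (x : G) = Monoid.Coprod.inl x := by
    intro x; rw [MulEquiv.symm_apply_eq]; simp [e]
  have hed : ∀ x : D, e.symm (x : G) = Monoid.Coprod.inr x := by
    intro x; rw [MulEquiv.symm_apply_eq]; simp [e]
  constructor
  · have h3 : ((Monoid.Coprod.lift α δ).comp e.symm.toMonoidHom).comp (FreeGroup.lift u) =
        MonoidHom.id _ := by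
      ext1 i
      rcases i with i | i
      · simp [hu, hea, hα]
      · simp [hu, hed, hδ]
    intro x y hxy
    have := congrArg ((Monoid.Coprod.lift α δ).comp e.symm.toMonoidHom) hxy
    rw [← MonoidHom.comp_apply, ← MonoidHom.comp_apply, h3] at this
    exact this
  · have hA : ∀ x : A, (x : G) ∈ (FreeGroup.lift u).range := by
      intro x
      obtain ⟨w, rfl⟩ := ha.2 x
      have : A.subtype.comp (FreeGroup.lift a) =
          (FreeGroup.lift u).comp (FreeGroup.map Sum.inl) := by
        ext1 i; simp [hu]
      exact ⟨_, (DFunLike.congr_fun this w).symm⟩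
    have hD : ∀ x : D, (x : G) ∈ (FreeGroup.lift u).range := by
      intro x
      obtain ⟨w, rfl⟩ := hd.2 x
      have : D.subtype.comp (FreeGroup.lift d) =
          (FreeGroup.lift u).comp (FreeGroup.map Sum.inr) := by
        ext1 i; simp [hu]
      exact ⟨_, (DFunLike.congr_fun this w).symm⟩
    intro g
    obtain ⟨w, rfl⟩ := h.2 g
    change _ ∈ (FreeGroup.lift u).range
    induction w using Monoid.Coprod.induction_on with
    | inl x => simpa using hA x
    | inr x => simpa using hD x
    | mul x y hx hy => rw [map_mul]; exact mul_mem hx hy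

/-- Every subgroup of a group with a basis has a basis. -/
theorem exists_basis {G X : Type} [Group G] (b : X → G) (hb : IsFreeBasis b) (H : Subgroup G) :
    ∃ (ι : Type) (v : ι → H), IsFreeBasis v := by
  obtain ⟨ι, κ, v, hv, -⟩ := main b hb H Set.univ
  exact ⟨_, v, hv⟩

end FFI

theorem statement4 {n : ℕ} (A B : Subgroup (FreeGroup (Fin n)))
    (hA : IsFreeFactor A) (hB : IsFreeFactor B) : IsFreeFactor (A ⊓ B) := by
  obtain ⟨C, hC⟩ := hA
  obtain ⟨D, hD⟩ := hB
  have h0 : IsFreeBasis (FreeGroup.of : Fin n → FreeGroup (Fin n)) := by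
    unfold IsFreeBasis
    have : FreeGroup.lift (FreeGroup.of : Fin n → FreeGroup (Fin n)) = MonoidHom.id _ := by
      ext1 i; simp
    rw [this]; exact Function.bijective_id
  obtain ⟨ι, a, ha⟩ := FFI.exists_basis _ h0 A
  obtain ⟨κ, c, hc⟩ := FFI.exists_basis _ h0 C
  obtain ⟨μ, d, hd⟩ := FFI.exists_basis _ h0 D
  have hu := FFI.basis_sum A C hC a c ha hc
  obtain ⟨ι', κ', v, hv, hvA⟩ := FFI.main _ hu B (Set.range Sum.inl)
  have hw := FFI.basis_sum B D hD v d hv hd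
  have hAcl : Subgroup.closure ((Sum.elim (fun i => (a i : FreeGroup (Fin n)))
      (fun i => (c i : FreeGroup (Fin n)))) '' (Set.range Sum.inl)) = A := by
    have := congrArg (Subgroup.map A.subtype) (FFI.closure_eq_top a ha)
    rw [MonoidHom.map_closure, ← MonoidHom.range_eq_map, Subgroup.range_subtype] at this
    refine Eq.trans ?_ this
    congr 1
    ext y; simp
  rw [hAcl] at hvA
  let w := Sum.elim (fun i => (v i : FreeGroup (Fin n))) (fun i => (d i : FreeGroup (Fin n)))
  let e := (Equiv.sumAssoc ι' κ' μ).symm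
  have hwe : IsFreeBasis (w ∘ e) := by
    have : (FreeGroup.lift (w ∘ e)) =
        (FreeGroup.lift w).comp (FreeGroup.freeGroupCongr e).toMonoidHom := by
      ext1 i; simp
    unfold IsFreeBasis
    rw [this, MonoidHom.coe_comp]
    exact Function.Bijective.comp hw (FreeGroup.freeGroupCongr e).bijective
  have hfin := FFI.isFreeFactor_of_basis (w ∘ e) hwe
  have : Subgroup.closure (Set.range ((w ∘ e) ∘ Sum.inl)) = A ⊓ B := by
    have := congrArg (Subgroup.map B.subtype) hvA
    rw [MonoidHom.map_closure, Subgroup.subgroupOf_map_subtype] at this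
    rw [← this]
    congr 1
    ext y; simp [w, e]
  rwa [this] at hfin
end

section
/- For every subgroup H of a finitely generated free group F_n, there exists a unique free factor B of F_n containing H of minimum rank; moreover, B is minimum with respect to inclusion among all free factors of F_n containing H. -/
open Monoid in
/-- The image of the left factor under an isomorphism from a free product is a free factor. -/
lemma isFreeFactor_of_coprod {M N G : Type} [Group M] [Group N] [Group G]
    (f : Coprod M N →* G) (hf : Function.Bijective f) :
    IsFreeFactor (f.comp Coprod.inl).range := by
  have h1 : Function.Injective (f.comp Coprod.inl) := hf.1.comp Coprod.inl_injective
  have h2 : Function.Injective (f.comp Coprod.inr) := hf.1.comp Coprod.inr_injective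
  refine ⟨(f.comp Coprod.inr).range, ?_⟩
  let e := MulEquiv.coprodCongr (MonoidHom.ofInjective h1) (MonoidHom.ofInjective h2)
  have key : (Coprod.lift (f.comp Coprod.inl).range.subtype
      (f.comp Coprod.inr).range.subtype).comp e.toMonoidHom = f := by
    apply Coprod.hom_ext <;> rfl
  have h3 : Function.Bijective ((Coprod.lift (f.comp Coprod.inl).range.subtype
      (f.comp Coprod.inr).range.subtype) ∘ e) := by
    have : ((Coprod.lift (f.comp Coprod.inl).range.subtype
      (f.comp Coprod.inr).range.subtype) ∘ e) = f := by
      funext x; exact DFunLike.congr_fun key x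
    rw [this]; exact hf
  exact (Function.Bijective.of_comp_iff _ e.bijective).1 h3

open Monoid in
lemma isFreeFactor_trans {G : Type} [Group G] (B : Subgroup G) (Z : Subgroup B)
    (hB : IsFreeFactor B) (hZ : IsFreeFactor Z) : IsFreeFactor (Z.map B.subtype) := by
  obtain ⟨C, hC⟩ := hB
  obtain ⟨D, hD⟩ := hZ
  let e1 := MulEquiv.ofBijective _ hC
  let e2 := MulEquiv.ofBijective _ hD
  let e : Coprod Z (Coprod D C) ≃* G :=
    (MulEquiv.coprodAssoc Z D C).symm.trans ((MulEquiv.coprodCongr e2 (MulEquiv.refl C)).trans e1)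
  have := isFreeFactor_of_coprod e.toMonoidHom e.bijective
  convert this using 1
  ext x
  simp only [Subgroup.mem_map, MonoidHom.mem_range]
  constructor
  · rintro ⟨z, hz, rfl⟩
    exact ⟨⟨z, hz⟩, rfl⟩
  · rintro ⟨z, rfl⟩
    exact ⟨z.1, z.2, rfl⟩

open Classical in
/-- Spanning forest of the Schreier graph relative to a nonempty set `U` of vertices. -/
lemma exists_forest {F S V : Type} [Group F] (y : S → F)
    (hgen : Subgroup.closure (Set.range y) = ⊤) [MulAction F V] [MulAction.IsPretransitive F V]
    (U : Set V) (v0 : V) (hv0 : v0 ∈ U) (base : V → F) :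
    ∃ (t : V → F) (T : Set (S × V)) (d : V → ℕ), (∀ v ∈ U, t v = base v) ∧
      (∀ s v, (s, v) ∈ T → t (y s • v) = y s * t v) ∧
      (∀ s v, (s, v) ∈ T → v ∉ U ∨ y s • v ∉ U) ∧
      (∀ v, v ∉ U → ∃ s u, d u < d v ∧
        ((y s • u = v ∧ (s, u) ∈ T) ∨ (y s • v = u ∧ (s, v) ∈ T))) := by
  let W : ℕ → Set V := fun n => Nat.rec U
    (fun _ X => {v | ∃ u ∈ X, ∃ s, y s • u = v ∨ y s • v = u}) n
  have hW0 : W 0 = U := rfl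
  have hWs : ∀ n, W (n + 1) = {v | ∃ u ∈ W n, ∃ s, y s • u = v ∨ y s • v = u} := fun n => rfl
  have hcl : ∀ g ∈ Subgroup.closure (Set.range y), ∀ v, (∃ n, v ∈ W n) ↔ (∃ n, g • v ∈ W n) := by
    intro g hg
    induction hg using Subgroup.closure_induction with
    | mem x hx =>
      obtain ⟨s, rfl⟩ := hx
      intro v
      constructor
      · rintro ⟨n, hn⟩
        exact ⟨n + 1, v, hn, s, Or.inl rfl⟩
      · rintro ⟨n, hn⟩
        exact ⟨n + 1, _, hn, s, Or.inr rfl⟩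
    | one => simp
    | mul a b _ _ ha hb =>
      intro v
      rw [hb v, ha, mul_smul]
    | inv a _ ha =>
      intro v
      rw [ha (a⁻¹ • v), smul_inv_smul]
  have hall : ∀ v, ∃ n, v ∈ W n := by
    intro v
    obtain ⟨g, rfl⟩ := MulAction.exists_smul_eq F v0 v
    exact (hcl g (by rw [hgen]; trivial) v0).1 ⟨0, hv0⟩
  let d : V → ℕ := fun v => @Nat.find (fun n => v ∈ W n) (fun _ => Classical.propDecidable _) (hall v)
  have hpar : ∀ v, v ∉ U → ∃ s u, d u < d v ∧ (y s • u = v ∨ y s • v = u) := by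
    intro v hv
    have h1 : v ∈ W (d v) := @Nat.find_spec (fun n => v ∈ W n) (fun _ => Classical.propDecidable _) (hall v)
    rcases hd : d v with _ | k
    · rw [hd] at h1; exact absurd h1 hv
    · rw [hd] at h1
      obtain ⟨u, hu, s, hs⟩ := h1
      exact ⟨s, u, Nat.lt_succ_of_le (@Nat.find_min' (fun n => u ∈ W n) (fun _ => Classical.propDecidable _) (hall u) _ hu), hs⟩
  choose s u hd hor using hpar
  let rf : ∀ v, (∀ w, d w < d v → F) → F := fun v r =>
    if hv : v ∈ U then base v else
      if y (s v hv) • u v hv = v then y (s v hv) * r (u v hv) (hd v hv)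
      else (y (s v hv))⁻¹ * r (u v hv) (hd v hv)
  let t : V → F := (measure d).wf.fix rf
  have ht : ∀ v, t v = if hv : v ∈ U then base v else
      if y (s v hv) • u v hv = v then y (s v hv) * t (u v hv)
      else (y (s v hv))⁻¹ * t (u v hv) := fun v => (measure d).wf.fix_eq rf v
  refine ⟨t, {e | ∃ v hv, e.1 = s v hv ∧ ((y (s v hv) • u v hv = v ∧ e.2 = u v hv) ∨
    (¬ y (s v hv) • u v hv = v ∧ e.2 = v))}, d, ?_, ?_, ?_, ?_⟩
  · intro v hv
    rw [ht, dif_pos hv]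
  · rintro s' v' ⟨v, hv, h1, h2⟩
    simp only at h1 h2
    subst h1
    rcases h2 with ⟨h2, rfl⟩ | ⟨h2, rfl⟩
    · rw [h2, ht v, dif_neg hv, if_pos h2]
    · have h3 := (hor v' hv).resolve_left h2
      rw [ht v', dif_neg hv, if_neg h2, h3, mul_inv_cancel_left]
  · rintro s' v' ⟨v, hv, h1, h2⟩
    simp only at h1 h2
    subst h1
    rcases h2 with ⟨h2, rfl⟩ | ⟨h2, rfl⟩
    · right; rwa [h2]
    · left; exact hv
  · intro v hv
    refine ⟨s v hv, u v hv, hd v hv, ?_⟩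
    by_cases h : y (s v hv) • u v hv = v
    · exact Or.inl ⟨h, v, hv, rfl, Or.inl ⟨h, rfl⟩⟩
    · exact Or.inr ⟨(hor v hv).resolve_left h, v, hv, rfl, Or.inr ⟨h, rfl⟩⟩

open Monoid Classical in
/-- The intersection of a subgroup `K` with a coordinate free factor is a free factor of `K`. -/
lemma isFreeFactor_subgroupOf_aux {F S : Type} [Group F] (y : S → F)
    (hgen : Subgroup.closure (Set.range y) = ⊤)
    (hext : ∀ (X : Type) [Group X] (f : S → X), ∃ φ : F →* X, ∀ s, φ (y s) = f s)
    (P : Set S) (K A : Subgroup F) (hA : A = Subgroup.closure (y '' P)) :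
    IsFreeFactor (A.subgroupOf K) := by
  let V := F ⧸ K
  let v0 : V := ((1 : F) : F ⧸ K)
  have hstab : ∀ g : F, g • v0 = v0 ↔ g ∈ K := by
    intro g
    have : g • v0 = ((g : F) : F ⧸ K) := by
      change ((g * 1 : F) : F ⧸ K) = _
      rw [mul_one]
    rw [this]
    change ((g : F) : F ⧸ K) = ((1 : F) : F ⧸ K) ↔ _
    rw [QuotientGroup.eq]; simp
  let U : Set V := {v | ∃ a ∈ A, a • v0 = v}
  have hUA : ∀ a ∈ A, ∀ v, v ∈ U → a • v ∈ U := by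
    rintro a ha v ⟨b, hb, rfl⟩
    exact ⟨a * b, mul_mem ha hb, mul_smul _ _ _⟩
  have hv0 : v0 ∈ U := ⟨1, one_mem _, one_smul _ _⟩
  have hb0 : ∀ v : V, ∃ b : F, (v ∈ U → b ∈ A ∧ b • v0 = v) ∧ (v = v0 → b = 1) := by
    intro v
    by_cases h : v = v0
    · exact ⟨1, fun _ => ⟨one_mem _, by rw [h, one_smul]⟩, fun _ => rfl⟩
    · by_cases hv : v ∈ U
      · obtain ⟨a, ha, hav⟩ := hv
        exact ⟨a, fun _ => ⟨ha, hav⟩, fun h' => absurd h' h⟩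
      · exact ⟨1, fun h' => absurd h' hv, fun _ => rfl⟩
  choose base hbase hbase0 using hb0
  obtain ⟨t, T, d, htU, htT, hTU, hTd⟩ := exists_forest y hgen U v0 hv0 base
  have ht0 : t v0 = 1 := by rw [htU v0 hv0, hbase0 v0 rfl]
  have htA : ∀ v ∈ U, t v ∈ A := fun v hv => by rw [htU v hv]; exact (hbase v hv).1
  have htv : ∀ v, t v • v0 = v := by
    intro v
    induction hn : d v using Nat.strong_induction_on generalizing v with
    | _ n ih =>
      by_cases hv : v ∈ U
      · rw [htU v hv]; exact (hbase v hv).2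
      · obtain ⟨s, u, hdu, ⟨h1, h2⟩ | ⟨h1, h2⟩⟩ := hTd v hv
        · have h3 := htT s u h2
          rw [h1] at h3
          rw [h3, mul_smul, ih (d u) (hn ▸ hdu) u rfl, h1]
        · have h3 := htT s v h2
          rw [h1] at h3
          have h4 := ih (d u) (hn ▸ hdu) u rfl
          rw [h3, mul_smul, ← h1] at h4
          exact smul_left_cancel _ h4
  have hPA : ∀ s ∈ P, y s ∈ A := fun s hs => by
    rw [hA]; exact Subgroup.subset_closure ⟨s, hs, rfl⟩
  have hloop : ∀ (g : F) (v : V), (t (g • v))⁻¹ * g * t v ∈ K := by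
    intro g v
    rw [← hstab, mul_smul, mul_smul, htv, inv_smul_eq_iff, htv]
  let loop : F → V → K := fun g v => ⟨(t (g • v))⁻¹ * g * t v, hloop g v⟩
  have hloopA : ∀ a ∈ A, ∀ v ∈ U, loop a v ∈ A.subgroupOf K := by
    intro a ha v hv
    rw [Subgroup.mem_subgroupOf]
    exact mul_mem (mul_mem (inv_mem (htA _ (hUA a ha v hv))) ha) (htA v hv)
  let E := {e : S × V // e ∉ T ∧ ¬ (e.1 ∈ P ∧ e.2 ∈ U)}
  let X := Coprod (A.subgroupOf K) (FreeGroup E)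
  let ψ : X →* K := Coprod.lift (A.subgroupOf K).subtype
    (FreeGroup.lift fun e : E => loop (y e.1.1) e.1.2)
  let f : S → V → X := fun s v =>
    if h : s ∈ P ∧ v ∈ U then Coprod.inl ⟨loop (y s) v, hloopA _ (hPA s h.1) v h.2⟩
    else if h' : (s, v) ∈ T then 1
    else Coprod.inr (FreeGroup.of ⟨(s, v), h', h⟩)
  have hTA : ∀ s v, (s, v) ∈ T → ¬ (s ∈ P ∧ v ∈ U) := by
    rintro s v hT ⟨hs, hv⟩
    rcases hTU s v hT with h | h
    · exact h hv
    · exact h (hUA _ (hPA s hs) v hv)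
  let perm : S → Equiv.Perm (V × X) := fun s =>
    { toFun := fun p => (y s • p.1, f s p.1 * p.2)
      invFun := fun p => ((y s)⁻¹ • p.1, (f s ((y s)⁻¹ • p.1))⁻¹ * p.2)
      left_inv := by
        rintro ⟨v, x⟩
        simp only [inv_smul_smul]
        exact congrArg (Prod.mk v) (inv_mul_cancel_left (f s v) x)
      right_inv := by
        rintro ⟨v, x⟩
        simp only [smul_inv_smul]
        exact congrArg (Prod.mk v) (mul_inv_cancel_left (f s ((y s)⁻¹ • v)) x) }
  obtain ⟨ρ, hρ⟩ := hext (Equiv.Perm (V × X)) perm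
  have hρs : ∀ s v x, ρ (y s) (v, x) = (y s • v, f s v * x) := by
    intro s v x; rw [hρ]; rfl
  -- behaviour on `A`
  have hρA : ∀ a (ha : a ∈ A), ∀ v (hv : v ∈ U) (x : X),
      ρ a (v, x) = (a • v, Coprod.inl ⟨loop a v, hloopA a ha v hv⟩ * x) := by
    intro a ha
    have ha' := ha
    rw [hA] at ha'
    induction ha' using Subgroup.closure_induction with
    | mem g hg =>
      obtain ⟨s, hs, rfl⟩ := hg
      intro v hv x
      rw [hρs]
      simp only [f]
      rw [dif_pos ⟨hs, hv⟩]
    | one =>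
      intro v hv x
      have : (⟨loop 1 v, hloopA 1 ha v hv⟩ : A.subgroupOf K) = 1 := by
        apply Subtype.ext; apply Subtype.ext
        simp [loop]
      rw [this]; simp
    | mul a b ha1 hb1 iha ihb =>
      intro v hv x
      rw [← hA] at ha1 hb1
      rw [map_mul, Equiv.Perm.mul_apply, ihb hb1 v hv, iha ha1 _ (hUA b hb1 v hv), ← mul_assoc,
        ← map_mul, mul_smul]
      congr 3
      apply Subtype.ext; apply Subtype.ext
      simp [loop, mul_smul, mul_assoc]
    | inv a ha1 iha =>
      intro v hv x
      rw [← hA] at ha1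
      rw [map_inv, Equiv.Perm.inv_eq_iff_eq, iha ha1 _ (hUA _ ha v hv), ← mul_assoc, ← map_mul]
      have : (⟨loop a (a⁻¹ • v), hloopA a ha1 _ (hUA _ ha v hv)⟩ : A.subgroupOf K) *
          ⟨loop a⁻¹ v, hloopA _ ha v hv⟩ = 1 := by
        apply Subtype.ext; apply Subtype.ext
        simp [loop, mul_assoc]
      rw [this]; simp
  have hρt : ∀ v x, ρ (t v) (v0, x) = (v, x) := by
    intro v
    induction hn : d v using Nat.strong_induction_on generalizing v with
    | _ n ih =>
      intro x
      by_cases hv : v ∈ U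
      · rw [hρA _ (htA v hv) v0 hv0, htv]
        have : (⟨loop (t v) v0, hloopA _ (htA v hv) v0 hv0⟩ : A.subgroupOf K) = 1 := by
          apply Subtype.ext; apply Subtype.ext
          simp [loop, htv, ht0]
        rw [this]; simp
      · obtain ⟨s, u, hdu, ⟨h1, h2⟩ | ⟨h1, h2⟩⟩ := hTd v hv
        · have h3 := htT s u h2
          have hf : f s u = 1 := by
            simp only [f]; rw [dif_neg (hTA _ _ h2), dif_pos h2]
          rw [h1] at h3
          rw [h3, map_mul, Equiv.Perm.mul_apply, ih (d u) (hn ▸ hdu) u rfl, hρs, h1, hf, one_mul]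
        · have h3 := htT s v h2
          have hf : f s v = 1 := by
            simp only [f]; rw [dif_neg (hTA _ _ h2), dif_pos h2]
          rw [h1] at h3
          have h4 := ih (d u) (hn ▸ hdu) u rfl x
          apply (ρ (y s)).injective
          rw [hρs s v x, h1, hf, one_mul, ← Equiv.Perm.mul_apply, ← map_mul, ← h3, h4]
  have hψ : ∀ w x, ρ (ψ w : K) (v0, x) = (v0, w * x) := by
    intro w
    induction w using Coprod.induction_on with
    | inl z =>
      intro x
      have hz : ((z : K) : F) ∈ A := Subgroup.mem_subgroupOf.1 z.2
      change ρ ((z : K) : F) (v0, x) = _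
      have h0 : ((z : K) : F) • v0 = v0 := (hstab _).2 (z : K).2
      rw [hρA _ hz v0 hv0, h0]
      congr 3
      apply Subtype.ext; apply Subtype.ext
      simp [loop, h0, ht0]
    | inr w =>
      change ∀ x, ρ ((FreeGroup.lift (fun e : E => loop (y e.1.1) e.1.2) w : K) : F) (v0, x) = _
      have gen : ∀ e : E, ∀ x, ρ ((loop (y e.1.1) e.1.2 : K) : F) (v0, x) =
          (v0, Coprod.inr (FreeGroup.of e) * x) := by
        rintro ⟨⟨s, v⟩, h1, h2⟩ x
        have hf : f s v = Coprod.inr (FreeGroup.of ⟨(s, v), h1, h2⟩) := by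
          simp only [f]; rw [dif_neg h2, dif_neg h1]
        change ρ ((t (y s • v))⁻¹ * y s * t v) (v0, x) = _
        rw [map_mul, map_mul, Equiv.Perm.mul_apply, Equiv.Perm.mul_apply, hρt, hρs, hf, map_inv,
          Equiv.Perm.inv_eq_iff_eq, hρt]
      induction w using FreeGroup.induction_on with
      | C1 => intro x; simp
      | of e => intro x; simpa using gen e x
      | inv_of e _ =>
        intro x
        rw [map_inv, Subgroup.coe_inv, map_inv, Equiv.Perm.inv_eq_iff_eq, FreeGroup.lift_apply_of,
          gen e, map_inv, mul_inv_cancel_left]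
      | mul a b ha hb =>
        intro x
        rw [map_mul, Subgroup.coe_mul, map_mul, Equiv.Perm.mul_apply, hb, ha, map_mul, mul_assoc]
    | mul a b ha hb =>
      intro x
      rw [map_mul, Subgroup.coe_mul, map_mul, Equiv.Perm.mul_apply, hb, ha, mul_assoc]
  have hinj : Function.Injective ψ := by
    intro a b hab
    have h1 := hψ a 1
    rw [hab, hψ b 1] at h1
    simpa using (Prod.ext_iff.1 h1).2.symm
  have hrange : ∀ g : F, ∀ v, loop g v ∈ ψ.range := by
    intro g
    have hg : g ∈ Subgroup.closure (Set.range y) := by rw [hgen]; trivial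
    induction hg using Subgroup.closure_induction with
    | mem g hg =>
      obtain ⟨s, rfl⟩ := hg
      intro v
      by_cases h : s ∈ P ∧ v ∈ U
      · exact ⟨Coprod.inl ⟨loop (y s) v, hloopA _ (hPA s h.1) v h.2⟩, rfl⟩
      · by_cases h' : (s, v) ∈ T
        · have : loop (y s) v = 1 := by
            apply Subtype.ext
            simp [loop, htT s v h']
          rw [this]; exact one_mem _
        · exact ⟨Coprod.inr (FreeGroup.of ⟨(s, v), h', h⟩),
            FreeGroup.lift_apply_of (f := fun e : E => loop (y e.1.1) e.1.2)
              (x := (⟨(s, v), h', h⟩ : E))⟩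
    | one =>
      intro v
      have : loop 1 v = 1 := by
        apply Subtype.ext
        simp [loop]
      rw [this]; exact one_mem _
    | mul a b _ _ iha ihb =>
      intro v
      have : loop (a * b) v = loop a (b • v) * loop b v := by
        apply Subtype.ext
        simp [loop, mul_smul, mul_assoc]
      rw [this]; exact mul_mem (iha _) (ihb _)
    | inv a _ iha =>
      intro v
      have : loop a⁻¹ v = (loop a (a⁻¹ • v))⁻¹ := by
        apply Subtype.ext
        simp [loop, mul_assoc]
      rw [this]; exact inv_mem (iha _)
  have hsurj : Function.Surjective ψ := by
    intro k
    obtain ⟨w, hw⟩ := hrange (k : F) v0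
    refine ⟨w, hw.trans ?_⟩
    apply Subtype.ext
    simp [loop, (hstab k).2 k.2, ht0]
  have := isFreeFactor_of_coprod ψ ⟨hinj, hsurj⟩
  convert this using 1
  ext x
  constructor
  · intro hx; exact ⟨⟨x, hx⟩, rfl⟩
  · rintro ⟨z, rfl⟩; exact z.2

open Monoid in
lemma isFreeFactor_subgroupOf {F : Type} [Group F] [IsFreeGroup F] (A K : Subgroup F)
    (hAf : IsFreeFactor A) : IsFreeFactor (A.subgroupOf K) := by
  obtain ⟨C, hC⟩ := hAf
  let e := MulEquiv.ofBijective _ hC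
  let bA := IsFreeGroup.basis A
  let bC := IsFreeGroup.basis C
  have hcl : ∀ B : Subgroup F, Subgroup.closure
      (Set.range fun i => ((IsFreeGroup.basis B i : B) : F)) = B := by
    intro B
    apply le_antisymm
    · rw [Subgroup.closure_le]; rintro _ ⟨i, rfl⟩; exact (IsFreeGroup.basis B i).2
    · intro x hx
      obtain ⟨w, hw⟩ := (IsFreeGroup.basis B).repr.symm.surjective ⟨x, hx⟩
      have : ∀ w, (((IsFreeGroup.basis B).repr.symm w : B) : F) ∈ Subgroup.closure
          (Set.range fun i => ((IsFreeGroup.basis B i : B) : F)) := by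
        intro w
        induction w using FreeGroup.induction_on with
        | C1 => simp
        | of i => exact Subgroup.subset_closure ⟨i, rfl⟩
        | inv_of i h => rw [map_inv]; exact inv_mem h
        | mul a b ha hb => rw [map_mul]; exact mul_mem ha hb
      have h := this w
      rwa [hw] at h
  let y : IsFreeGroup.Generators A ⊕ IsFreeGroup.Generators C → F :=
    Sum.elim (fun i => (bA i : F)) (fun j => (bC j : F))
  have hyA : y '' Set.range Sum.inl = Set.range fun i => (bA i : F) := by
    rw [← Set.range_comp]; rfl
  refine isFreeFactor_subgroupOf_aux y ?_ ?_ (Set.range Sum.inl) K A (by rw [hyA]; exact (hcl A).symm)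
  · have : Set.range y = (Set.range fun i => (bA i : F)) ∪ (Set.range fun i => (bC i : F)) :=
      Set.Sum.elim_range _ _
    rw [this, Subgroup.closure_union, hcl A, hcl C]
    have h := MonoidHom.range_eq_top.2 hC.2
    rw [Coprod.range_lift] at h
    simpa using h
  · intro X _ f
    refine ⟨(Coprod.lift (bA.lift fun i => f (Sum.inl i)) (bC.lift fun j => f (Sum.inr j))).comp
      e.symm.toMonoidHom, ?_⟩
    rintro (i | j)
    · have : e.symm (bA i : F) = Coprod.inl (bA i) := by
        rw [MulEquiv.symm_apply_eq]; rfl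
      change Coprod.lift _ _ (e.symm (bA i : F)) = _
      rw [this, Coprod.lift_apply_inl]
      simp
    · have : e.symm (bC j : F) = Coprod.inr (bC j) := by
        rw [MulEquiv.symm_apply_eq]; rfl
      change Coprod.lift _ _ (e.symm (bC j : F)) = _
      rw [this, Coprod.lift_apply_inr]
      simp

open Monoid in
/-- The free product of two free groups is free on the disjoint union. -/
noncomputable def coprodFreeGroupEquiv (I J : Type) :
    Coprod (FreeGroup I) (FreeGroup J) ≃* FreeGroup (I ⊕ J) :=
  MonoidHom.toMulEquiv
    (Coprod.lift (FreeGroup.map Sum.inl) (FreeGroup.map Sum.inr))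
    (FreeGroup.lift (Sum.elim (fun i => Coprod.inl (FreeGroup.of i))
      (fun j => Coprod.inr (FreeGroup.of j))))
    (by apply Coprod.hom_ext <;> ext <;> simp)
    (by ext (i | j) <;> simp)

open Monoid in
lemma rank_split {G : Type} [Group G] {r : ℕ} (e : FreeGroup (Fin r) ≃* G) (Z C : Subgroup G)
    (h : Function.Bijective (Coprod.lift Z.subtype C.subtype)) :
    ∃ p q : ℕ, p + q = r ∧ Nonempty (FreeGroup (Fin p) ≃* Z) ∧
      Nonempty (FreeGroup (Fin q) ≃* C) := by
  have : IsFreeGroup G := IsFreeGroup.ofMulEquiv e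
  let eZ := IsFreeGroup.mulEquiv Z
  let eC := IsFreeGroup.mulEquiv C
  let e' : FreeGroup (IsFreeGroup.Generators Z ⊕ IsFreeGroup.Generators C) ≃* FreeGroup (Fin r) :=
    (coprodFreeGroupEquiv _ _).symm.trans ((MulEquiv.coprodCongr eZ eC).trans
      ((MulEquiv.ofBijective _ h).trans e.symm))
  let σ := Equiv.ofFreeGroupEquiv e'
  have : Finite (IsFreeGroup.Generators Z ⊕ IsFreeGroup.Generators C) := Finite.of_equiv _ σ.symm
  have : Finite (IsFreeGroup.Generators Z) := Finite.sum_left (IsFreeGroup.Generators C)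
  have : Finite (IsFreeGroup.Generators C) := Finite.sum_right (IsFreeGroup.Generators Z)
  refine ⟨Nat.card (IsFreeGroup.Generators Z), Nat.card (IsFreeGroup.Generators C), ?_,
    ⟨(FreeGroup.freeGroupCongr (Finite.equivFin _)).symm.trans eZ⟩,
    ⟨(FreeGroup.freeGroupCongr (Finite.equivFin _)).symm.trans eC⟩⟩
  rw [← Nat.card_sum, Nat.card_congr σ, Nat.card_fin]

open Monoid in
lemma isFreeFactor_top {G : Type} [Group G] : IsFreeFactor (⊤ : Subgroup G) := by
  have h := isFreeFactor_of_coprod (MulEquiv.coprodPUnit (M := G)).toMonoidHom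
    (MulEquiv.coprodPUnit (M := G)).bijective
  convert h using 1
  symm
  rw [eq_top_iff]
  intro x _
  exact ⟨x, rfl⟩

/-- A minimum rank free factor containing `H` lies in every free factor containing `H`. -/
lemma min_le {F : Type} [Group F] [IsFreeGroup F] (H B : Subgroup F)
    (hB : IsFreeFactor B) (hHB : H ≤ B) (r : ℕ) (hr : HasRank B r)
    (hmin : ∀ (B' : Subgroup F) (r' : ℕ),
      IsFreeFactor B' → H ≤ B' → HasRank B' r' → r ≤ r')
    (B' : Subgroup F) (hB' : IsFreeFactor B') (hHB' : H ≤ B') : B ≤ B' := by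
  have hZ := isFreeFactor_subgroupOf B' B hB'
  have hI := isFreeFactor_trans B _ hB hZ
  obtain ⟨C, hC⟩ := hZ
  obtain ⟨e⟩ := hr
  obtain ⟨p, q, hpq, ⟨ep⟩, ⟨eq⟩⟩ := rank_split e _ C hC
  have h1 : r ≤ p := by
    refine hmin _ p hI ?_
      ⟨ep.trans (Subgroup.equivMapOfInjective _ B.subtype B.subtype_injective)⟩
    rw [Subgroup.subgroupOf_map_subtype]
    exact le_inf hHB' hHB
  have hq : q = 0 := by omega
  subst hq
  have hCt : ∀ c : C, c = 1 := by
    intro c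
    obtain ⟨w, rfl⟩ := eq.surjective c
    rw [Subsingleton.elim w 1, map_one]
  have hCb : C = ⊥ := by
    rw [Subgroup.eq_bot_iff_forall]
    intro x hx
    exact congrArg Subtype.val (hCt ⟨x, hx⟩)
  have h := MonoidHom.range_eq_top.2 hC.2
  rw [Monoid.Coprod.range_lift] at h
  simp only [Subgroup.range_subtype, hCb, sup_bot_eq] at h
  exact Subgroup.subgroupOf_eq_top.1 h

theorem statement5 {n : ℕ} (H : Subgroup (FreeGroup (Fin n))) :
    ∃ B : Subgroup (FreeGroup (Fin n)),
      (IsFreeFactor B ∧ H ≤ B ∧ ∃ r : ℕ, HasRank B r ∧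
        ∀ (B' : Subgroup (FreeGroup (Fin n))) (r' : ℕ),
          IsFreeFactor B' → H ≤ B' → HasRank B' r' → r ≤ r') ∧
      (∀ B'' : Subgroup (FreeGroup (Fin n)),
        (IsFreeFactor B'' ∧ H ≤ B'' ∧ ∃ r : ℕ, HasRank B'' r ∧
          ∀ (B' : Subgroup (FreeGroup (Fin n))) (r' : ℕ),
            IsFreeFactor B' → H ≤ B' → HasRank B' r' → r ≤ r') → B'' = B) ∧
      (∀ B' : Subgroup (FreeGroup (Fin n)), IsFreeFactor B' → H ≤ B' → B ≤ B') := by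
  classical
  have hex : ∃ r : ℕ, ∃ B : Subgroup (FreeGroup (Fin n)),
      IsFreeFactor B ∧ H ≤ B ∧ HasRank B r :=
    ⟨n, ⊤, isFreeFactor_top, le_top, ⟨Subgroup.topEquiv.symm⟩⟩
  obtain ⟨B, hB, hHB, hr⟩ := Nat.find_spec hex
  have hmin : ∀ (B' : Subgroup (FreeGroup (Fin n))) (r' : ℕ),
      IsFreeFactor B' → H ≤ B' → HasRank B' r' → Nat.find hex ≤ r' :=
    fun B' r' h1 h2 h3 => Nat.find_min' hex ⟨B', h1, h2, h3⟩
  have hle := min_le H B hB hHB _ hr hmin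
  refine ⟨B, ⟨hB, hHB, _, hr, hmin⟩, ?_, hle⟩
  rintro B'' ⟨h1, h2, r, h3, h4⟩
  exact le_antisymm (min_le H B'' h1 h2 r h3 h4 B hB hHB) (hle B'' h1 h2)
end

section
/- Let H be a finitely generated subgroup of the free group F_n of rank r. Then H admits an echelon basis if and only if H admits a flag, i.e. a chain of free factors B_1 ≤ B_2 ≤ ... ≤ B_r ≤ F_n with rank(H ∩ B_i) = i for i = 1,...,r. -/
lemma rec_exists {Q F : Type} [Group F] (v0 : Q) (par : Q → Q) (l : Q → F) (r : Q → Q → Prop)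
    (wf : WellFounded r) (h : ∀ v, v ≠ v0 → r (par v) v) :
    ∃ t : Q → F, t v0 = 1 ∧ ∀ v, v ≠ v0 → t v = l v * t (par v) := by
  classical
  refine ⟨wf.fix (fun v ih => if hv : v = v0 then 1 else l v * ih (par v) (h v hv)), ?_, ?_⟩
  · rw [WellFounded.fix_eq]; simp
  · intro v hv
    rw [WellFounded.fix_eq]; simp [hv]

lemma letter_mem {X : Type} (S : Set X) (p : X × Bool) (hp : p.1 ∈ S) :
    FreeGroup.mk [p] ∈ Subgroup.closure (FreeGroup.of '' S) := by
  obtain ⟨x, b⟩ := p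
  have h : FreeGroup.of x ∈ Subgroup.closure (FreeGroup.of '' S) :=
    Subgroup.subset_closure ⟨x, hp, rfl⟩
  cases b
  · have := inv_mem h
    simpa [FreeGroup.of, FreeGroup.inv_mk, FreeGroup.invRev] using this
  · exact h

/-- Elements of the subgroup on `S` are spelled by words in `S`. -/
lemma exists_word {X : Type} (S : Set X) (g : FreeGroup X)
    (hg : g ∈ Subgroup.closure (FreeGroup.of '' S)) :
    ∃ L : List (X × Bool), FreeGroup.mk L = g ∧ ∀ p ∈ L, p.1 ∈ S := by
  induction hg using Subgroup.closure_induction with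
  | mem x hx =>
    obtain ⟨x, hx, rfl⟩ := hx
    exact ⟨[(x, true)], rfl, by simpa using hx⟩
  | one => exact ⟨[], rfl, by simp⟩
  | mul a b _ _ iha ihb =>
    obtain ⟨L, rfl, hL⟩ := iha
    obtain ⟨M, rfl, hM⟩ := ihb
    refine ⟨L ++ M, by rw [FreeGroup.mul_mk], ?_⟩
    intro p hp
    rcases List.mem_append.1 hp with h | h
    · exact hL p h
    · exact hM p h
  | inv a _ iha =>
    obtain ⟨L, rfl, hL⟩ := iha
    refine ⟨FreeGroup.invRev L, by rw [FreeGroup.inv_mk], ?_⟩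
    intro p hp
    simp only [FreeGroup.invRev, List.mem_reverse, List.mem_map] at hp
    obtain ⟨q, hq, rfl⟩ := hp
    exact hL q hq

open Classical in
/-- Existence of a Schreier transversal adapted to the free factor on `S`. -/
lemma exists_transversal_s6 {X : Type} (H : Subgroup (FreeGroup X)) (S : Set X) :
    ∃ t : FreeGroup X ⧸ H → FreeGroup X, t ((1 : FreeGroup X) : FreeGroup X ⧸ H) = 1 ∧
      (∀ v, ((t v : FreeGroup X) : FreeGroup X ⧸ H) = v) ∧
      (∀ g ∈ Subgroup.closure (FreeGroup.of '' S),
        t (g : FreeGroup X ⧸ H) ∈ Subgroup.closure (FreeGroup.of '' S)) ∧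
      (∀ P : FreeGroup X ⧸ H → Prop, P ((1 : FreeGroup X) : FreeGroup X ⧸ H) →
        (∀ x v, t (FreeGroup.of x • v) = FreeGroup.of x * t v →
          (P v ↔ P (FreeGroup.of x • v))) → ∀ v, P v) := by
  set v0 : FreeGroup X ⧸ H := ((1 : FreeGroup X) : FreeGroup X ⧸ H) with hv0
  let cnt : List (X × Bool) → ℕ := fun L => L.countP (fun p => decide (p.1 ∉ S))
  let m : List (X × Bool) → ℕ ×ₗ ℕ := fun L => toLex (cnt L, L.length)
  have hmin : ∀ v : FreeGroup X ⧸ H, ∃ L : List (X × Bool),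
      ((FreeGroup.mk L : FreeGroup X) : FreeGroup X ⧸ H) = v ∧
      ∀ M, ((FreeGroup.mk M : FreeGroup X) : FreeGroup X ⧸ H) = v → ¬ m M < m L := by
    intro v
    have hne : {L : List (X × Bool) | ((FreeGroup.mk L : FreeGroup X) : FreeGroup X ⧸ H) = v}.Nonempty := by
      obtain ⟨g, rfl⟩ := QuotientGroup.mk_surjective v
      exact ⟨g.toWord, by simp [FreeGroup.mk_toWord]⟩
    obtain ⟨L, hL, hLm⟩ := (InvImage.wf m (wellFounded_lt (α := ℕ ×ₗ ℕ))).has_min _ hne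
    exact ⟨L, hL, fun M hM => hLm M hM⟩
  choose L hL hLm using hmin
  have hstep : ∀ v, v ≠ v0 → ∃ (u : FreeGroup X ⧸ H) (l : FreeGroup X), m (L u) < m (L v) ∧
      v = l • u ∧ ∃ p : X × Bool, l = FreeGroup.mk [p] ∧
        (cnt (L v) = 0 → p.1 ∈ S ∧ cnt (L u) = 0) := by
    intro v hv
    rcases hLv : L v with _ | ⟨p, L'⟩
    · exfalso
      apply hv
      rw [← hL v, hLv]; rfl
    · refine ⟨((FreeGroup.mk L' : FreeGroup X) : FreeGroup X ⧸ H), FreeGroup.mk [p], ?_, ?_, p, rfl, ?_⟩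
      · refine lt_of_le_of_lt (not_lt.1 (hLm _ L' rfl)) ?_
        simp only [m, cnt, Prod.Lex.toLex_lt_toLex, List.countP_cons, List.length_cons]
        split_ifs <;> omega
      · rw [← hL v, hLv, MulAction.Quotient.smul_coe, smul_eq_mul, FreeGroup.mul_mk]; rfl
      · intro h0
        have h1 := not_lt.1 (hLm ((FreeGroup.mk L' : FreeGroup X) : FreeGroup X ⧸ H) L' rfl)
        simp only [m, Prod.Lex.toLex_le_toLex] at h1
        simp only [cnt, List.countP_cons] at h0 h1 ⊢
        refine ⟨?_, by omega⟩
        by_contra hp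
        simp [hp] at h0
  choose! par l hlt hpar hcnt using hstep
  obtain ⟨t, ht0, ht⟩ := rec_exists v0 par l
    (fun u v => m (L u) < m (L v)) (InvImage.wf (fun v => m (L v)) (wellFounded_lt (α := ℕ ×ₗ ℕ))) hlt
  have hind : ∀ P : FreeGroup X ⧸ H → Prop, P v0 → (∀ v, v ≠ v0 → P (par v) → P v) → ∀ v, P v := by
    intro P h0 hs v
    induction v using (InvImage.wf (fun v => m (L v)) (wellFounded_lt (α := ℕ ×ₗ ℕ))).induction with
    | _ v ih =>
      by_cases hv : v = v0
      · rw [hv]; exact h0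
      · exact hs v hv (ih _ (hlt v hv))
  have htv : ∀ v, ((t v : FreeGroup X) : FreeGroup X ⧸ H) = v := by
    apply hind
    · rw [ht0]
    · intro v hv ih
      rw [ht v hv]
      conv_rhs => rw [hpar v hv, ← ih]
      rfl
  refine ⟨t, ht0, htv, ?_, ?_⟩
  · have key : ∀ v, cnt (L v) = 0 → t v ∈ Subgroup.closure (FreeGroup.of '' S) := by
      apply hind
      · intro _; rw [ht0]; exact one_mem _
      · intro v hv ih h0
        rw [ht v hv]
        obtain ⟨p, hp, hp'⟩ := hcnt v hv
        rw [hp]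
        exact mul_mem (letter_mem S _ (hp' h0).1) (ih (hp' h0).2)
    intro g hg
    apply key
    obtain ⟨M, rfl, hM⟩ := exists_word S g hg
    have h1 := not_lt.1 (hLm _ M rfl)
    simp only [m, Prod.Lex.toLex_le_toLex] at h1
    have h2 : cnt M = 0 := by
      simp only [cnt, List.countP_eq_zero]
      intro a ha
      simp [hM a ha]
    omega
  · intro P h0 hs
    apply hind P h0
    intro v hv ih
    have e1 := ht v hv
    have e2 := hpar v hv
    obtain ⟨⟨x, b⟩, hp, -⟩ := hcnt v hv
    rw [hp] at e1 e2
    cases b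
    · have hx : FreeGroup.mk [(x, false)] = (FreeGroup.of x)⁻¹ := by
        simp [FreeGroup.of, FreeGroup.inv_mk, FreeGroup.invRev]
      rw [hx] at e1 e2
      have e3 : FreeGroup.of x • v = par v := by
        conv_lhs => rw [e2]
        simp
      rw [hs x v (by rw [e3, e1]; simp), e3]; exact ih
    · change v = FreeGroup.of x • par v at e2
      change t v = FreeGroup.of x * t (par v) at e1
      have := hs x (par v) (by rw [← e2, e1])
      rw [e2]; exact this.1 ih

open Classical in
/-- Nielsen–Schreier adapted to a free factor. -/
lemma kurosh_std {X : Type} (H : Subgroup (FreeGroup X)) (S : Set X) :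
    ∃ (I : Type) (s : I → FreeGroup X) (J : Set I), IsBasisOf s H ∧
      Subgroup.closure (s '' J) = H ⊓ Subgroup.closure (FreeGroup.of '' S) := by
  obtain ⟨t, ht0, htv, htA, hind⟩ := exists_transversal_s6 H S
  set v0 : FreeGroup X ⧸ H := ((1 : FreeGroup X) : FreeGroup X ⧸ H) with hv0
  set A := Subgroup.closure (FreeGroup.of '' S) with hA
  let s' : X × (FreeGroup X ⧸ H) → FreeGroup X := fun q =>
    (t (FreeGroup.of q.1 • q.2))⁻¹ * (FreeGroup.of q.1 * t q.2)
  have hbase : ∀ g : FreeGroup X, g • v0 = (g : FreeGroup X ⧸ H) := by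
    intro g; rw [hv0, MulAction.Quotient.smul_coe, smul_eq_mul, mul_one]
  have htb : ∀ v, t v • v0 = v := fun v => by rw [hbase, htv]
  have hstab : ∀ g : FreeGroup X, g • v0 = v0 ↔ g ∈ H := by
    intro g
    rw [hbase, hv0, eq_comm, QuotientGroup.eq]; simp
  have hs'H : ∀ q, s' q ∈ H := by
    intro q
    rw [← hstab]
    simp only [s', mul_smul, htb]
    rw [inv_smul_eq_iff, htb]
  let I := {q // s' q ≠ 1}
  let s : I → FreeGroup X := fun q => s' q.1
  let J : Set I := {q | q.1.1 ∈ S ∧ ∃ g ∈ A, g • v0 = q.1.2}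
  refine ⟨I, s, J, ⟨?_, ?_⟩, ?_⟩
  · let c : X → (FreeGroup X ⧸ H) → FreeGroup I := fun x v =>
      if h : s' (x, v) ≠ 1 then FreeGroup.of ⟨(x, v), h⟩ else 1
    let pm : X → Equiv.Perm ((FreeGroup X ⧸ H) × FreeGroup I) := fun x =>
      { toFun := fun q => (FreeGroup.of x • q.1, c x q.1 * q.2)
        invFun := fun q => ((FreeGroup.of x)⁻¹ • q.1, (c x ((FreeGroup.of x)⁻¹ • q.1))⁻¹ * q.2)
        left_inv := fun q => by simp
        right_inv := fun q => by simp }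
    let ρ : FreeGroup X →* Equiv.Perm ((FreeGroup X ⧸ H) × FreeGroup I) := FreeGroup.lift pm
    have hρ : ∀ x v k, ρ (FreeGroup.of x) (v, k) = (FreeGroup.of x • v, c x v * k) := by
      intro x v k
      simp only [ρ, FreeGroup.lift_apply_of]; rfl
    have ht : ∀ v, ∀ k, ρ (t v) (v0, k) = (v, k) := by
      apply hind
      · intro k; rw [ht0]; simp
      · intro x v hxv
        have hs1 : s' (x, v) = 1 := by simp [s', hxv]
        have hc : c x v = 1 := by simp [c, hs1]
        have : ∀ k, ρ (t (FreeGroup.of x • v)) (v0, k) = ρ (FreeGroup.of x) (ρ (t v) (v0, k)) := by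
          intro k; rw [hxv, map_mul]; rfl
        constructor
        · intro h k
          rw [this, h, hρ, hc, one_mul]
        · intro h k
          apply (ρ (FreeGroup.of x)).injective
          rw [← this, h, hρ, hc, one_mul]
    have hsρ : ∀ (i : I) k, ρ (s i) (v0, k) = (v0, FreeGroup.of i * k) := by
      rintro ⟨⟨x, v⟩, hi⟩ k
      have hc : c x v = FreeGroup.of ⟨(x, v), hi⟩ := by simp only [c]; rw [dif_pos hi]
      have : ρ (s ⟨(x, v), hi⟩) (v0, k) =
          (ρ (t (FreeGroup.of x • v)))⁻¹ (ρ (FreeGroup.of x) (ρ (t v) (v0, k))) := by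
        simp only [s, s', map_mul, map_inv]; rfl
      rw [this, ht, hρ, Equiv.Perm.inv_eq_iff_eq, ht, hc]
    have hw : ∀ (w : FreeGroup I) k, ρ (FreeGroup.lift s w) (v0, k) = (v0, w * k) := by
      intro w
      induction w using FreeGroup.induction_on with
      | C1 => intro k; simp
      | of i => intro k; rw [FreeGroup.lift_apply_of, hsρ]
      | inv_of i ih =>
        intro k
        rw [map_inv, map_inv, Equiv.Perm.inv_eq_iff_eq, ih]; simp
      | mul a b iha ihb =>
        intro k
        rw [map_mul, map_mul, Equiv.Perm.mul_apply, ihb, iha, mul_assoc]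
    rw [injective_iff_map_eq_one]
    intro w hw1
    have := hw w 1
    rw [hw1] at this
    simpa using this.symm
  · have hcl : ∀ q, s' q ∈ Subgroup.closure (Set.range s) := by
      intro q
      by_cases h : s' q = 1
      · rw [h]; exact one_mem _
      · exact Subgroup.subset_closure ⟨⟨q, h⟩, rfl⟩
    apply le_antisymm
    · rw [Subgroup.closure_le]
      rintro _ ⟨i, rfl⟩
      exact hs'H _
    · have hgen : ∀ g : FreeGroup X, ∀ v,
          (t (g • v))⁻¹ * (g * t v) ∈ Subgroup.closure (Set.range s) := by
        intro g
        induction g using FreeGroup.induction_on with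
        | C1 => intro v; simp [one_mem]
        | of x => intro v; exact hcl (x, v)
        | inv_of x ih =>
          intro v
          have := inv_mem (ih ((FreeGroup.of x)⁻¹ • v))
          simpa [mul_assoc] using this
        | mul a b iha ihb =>
          intro v
          have := mul_mem (iha (b • v)) (ihb v)
          simpa [mul_assoc, mul_smul] using this
      intro h hh
      have := hgen h v0
      rw [(hstab h).2 hh, ht0] at this
      simpa using this
  · have hcl : ∀ x ∈ S, ∀ v, (∃ g ∈ A, g • v0 = v) → s' (x, v) ∈ Subgroup.closure (s '' J) := by
      intro x hx v hv
      by_cases h : s' (x, v) = 1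
      · rw [h]; exact one_mem _
      · exact Subgroup.subset_closure ⟨⟨(x, v), h⟩, ⟨hx, hv⟩, rfl⟩
    have hof : ∀ x ∈ S, FreeGroup.of x ∈ A := fun x hx => Subgroup.subset_closure ⟨x, hx, rfl⟩
    apply le_antisymm
    · rw [Subgroup.closure_le]
      rintro _ ⟨⟨⟨x, v⟩, hi⟩, ⟨hx, g, hg, hgv⟩, rfl⟩
      refine ⟨hs'H _, ?_⟩
      simp only at hx hgv
      subst hgv
      have e1 : t (g • v0) ∈ A := by rw [hbase]; exact htA g hg
      have e2 : t (FreeGroup.of x • g • v0) ∈ A := by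
        rw [← mul_smul, hbase]; exact htA _ (mul_mem (hof x hx) hg)
      exact A.mul_mem (inv_mem e2) (mul_mem (hof x hx) e1)
    · have hgen : ∀ g ∈ A, ∀ v, (∃ g ∈ A, g • v0 = v) →
          (t (g • v))⁻¹ * (g * t v) ∈ Subgroup.closure (s '' J) := by
        intro g hg
        induction hg using Subgroup.closure_induction with
        | one => intro v _; simp [one_mem]
        | mem y hy =>
          obtain ⟨x, hx, rfl⟩ := hy
          intro v hv; exact hcl x hx v hv
        | inv y hy ih =>
          rintro v ⟨g, hg, rfl⟩
          have := inv_mem (ih (y⁻¹ • g • v0) ⟨y⁻¹ * g, mul_mem (inv_mem hy) hg, mul_smul _ _ _⟩)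
          simpa [mul_assoc] using this
        | mul a b ha hb iha ihb =>
          rintro v ⟨g, hg, rfl⟩
          have := mul_mem (iha (b • g • v0) ⟨b * g, mul_mem hb hg, mul_smul _ _ _⟩)
            (ihb _ ⟨g, hg, rfl⟩)
          simpa [mul_assoc, mul_smul] using this
      rintro h ⟨hh, hhA⟩
      have := hgen h hhA v0 ⟨1, one_mem _, one_smul _ _⟩
      rw [(hstab h).2 hh, ht0] at this
      simpa using this

lemma kurosh {G X : Type} [Group G] {b : X → G} (hb : IsFreeBasis b) (H : Subgroup G) (S : Set X) :
    ∃ (I : Type) (s : I → G) (J : Set I), IsBasisOf s H ∧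
      Subgroup.closure (s '' J) = H ⊓ Subgroup.closure (b '' S) := by
  obtain ⟨I, s, J, ⟨hinj, hcl⟩, hJ⟩ := kurosh_std (H.comap (FreeGroup.lift b)) S
  refine ⟨I, fun i => FreeGroup.lift b (s i), J, ⟨?_, ?_⟩, ?_⟩
  · have : FreeGroup.lift (fun i => FreeGroup.lift b (s i)) =
        (FreeGroup.lift b).comp (FreeGroup.lift s) := by
      ext i; simp
    rw [this]
    exact hb.1.comp hinj
  · have : Set.range (fun i => FreeGroup.lift b (s i)) = FreeGroup.lift b '' Set.range s := by
      rw [← Set.range_comp]; rfl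
    rw [this, ← MonoidHom.map_closure, hcl, Subgroup.map_comap_eq_self_of_surjective hb.2]
  · have h1 : (fun i => FreeGroup.lift b (s i)) '' J = FreeGroup.lift b '' (s '' J) := by
      rw [← Set.image_comp]; rfl
    have h2 : b '' S = FreeGroup.lift b '' (FreeGroup.of '' S) := by
      rw [← Set.image_comp]; congr 1; funext x; simp
    rw [h1, ← MonoidHom.map_closure, hJ, Subgroup.map_inf _ _ _ hb.1,
      Subgroup.map_comap_eq_self_of_surjective hb.2, h2, ← MonoidHom.map_closure]

/-- The isomorphism given by a basis. -/
noncomputable def basisEquiv {G I : Type} [Group G] {s : I → G} {H : Subgroup G}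
    (h : IsBasisOf s H) : FreeGroup I ≃* H :=
  (MonoidHom.ofInjective h.1).trans
    (MulEquiv.subgroupCongr (FreeGroup.range_lift_eq_closure.trans h.2))

lemma basisEquiv_coe {G I : Type} [Group G] {s : I → G} {H : Subgroup G}
    (h : IsBasisOf s H) (w : FreeGroup I) : (basisEquiv h w : G) = FreeGroup.lift s w := rfl

lemma basisEquiv_symm {G I : Type} [Group G] {s : I → G} {H : Subgroup G}
    (h : IsBasisOf s H) (i : I) (hi : s i ∈ H) : (basisEquiv h).symm ⟨s i, hi⟩ = FreeGroup.of i := by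
  rw [MulEquiv.symm_apply_eq]
  ext
  rw [basisEquiv_coe, FreeGroup.lift_apply_of]

lemma basis_mem {G I : Type} [Group G] {s : I → G} {H : Subgroup G}
    (h : IsBasisOf s H) (i : I) : s i ∈ H := by
  rw [← h.2]; exact Subgroup.subset_closure ⟨i, rfl⟩

lemma rank_unique {G : Type} [Group G] {H : Subgroup G} {m k : ℕ} (h : HasRank H m)
    (h' : HasRank H k) : m = k := by
  obtain ⟨e⟩ := h
  obtain ⟨e'⟩ := h'
  simpa using Fintype.card_congr (Equiv.ofFreeGroupEquiv (e.trans e'.symm))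

lemma basis_restrict {G I : Type} [Group G] {s : I → G} {H : Subgroup G}
    (h : IsBasisOf s H) (J : Set I) :
    IsBasisOf (fun j : J => s j) (Subgroup.closure (s '' J)) := by
  refine ⟨?_, ?_⟩
  · have : FreeGroup.lift (fun j : J => s j) =
        (FreeGroup.lift s).comp (FreeGroup.map Subtype.val) := by
      ext i; simp
    rw [this]
    refine h.1.comp ?_
    exact FreeGroup.map_injective Subtype.val_injective
  · congr 1
    rw [Set.image_eq_range]

lemma rank_mono {G X : Type} [Group G] {b : X → G} (hb : IsFreeBasis b) {H : Subgroup G}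
    {m : ℕ} (hm : HasRank H m) (S : Set X) :
    ∃ m' ≤ m, HasRank (H ⊓ Subgroup.closure (b '' S)) m' := by
  classical
  obtain ⟨I, s, J, hs, hJ⟩ := kurosh hb H S
  obtain ⟨e⟩ := hm
  have eq : I ≃ Fin m := Equiv.ofFreeGroupEquiv ((basisEquiv hs).trans e.symm)
  have : Fintype I := Fintype.ofEquiv _ eq.symm
  have hI : Fintype.card I = m := by simpa using Fintype.card_congr eq
  refine ⟨Fintype.card J, hI ▸ Fintype.card_subtype_le _, ?_⟩
  rw [← hJ]
  exact ⟨(FreeGroup.freeGroupCongr (Fintype.equivFin J).symm).trans (basisEquiv (basis_restrict hs J))⟩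

/-- Replace part of a basis by another basis of the same subgroup. -/
lemma basis_replace {G I I' : Type} [Group G] {s : I → G} {H A : Subgroup G}
    (h : IsBasisOf s H) (J : Set I) (hA : Subgroup.closure (s '' J) = A) {u : I' → G}
    (hu : IsBasisOf u A) :
    IsBasisOf (Sum.elim u (fun j : (Jᶜ : Set I) => s j)) H := by
  classical
  subst hA
  have hJ := basis_restrict h J
  refine ⟨?_, ?_⟩
  · -- the inverse map
    let f : FreeGroup J →* FreeGroup (I' ⊕ (Jᶜ : Set I)) :=
      (FreeGroup.map Sum.inl).comp ((basisEquiv hu).symm.toMonoidHom.comp (basisEquiv hJ).toMonoidHom)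
    let f' : FreeGroup I →* FreeGroup (I' ⊕ (Jᶜ : Set I)) :=
      FreeGroup.lift fun i => if hi : i ∈ J then f (FreeGroup.of ⟨i, hi⟩)
        else FreeGroup.of (Sum.inr ⟨i, hi⟩)
    let g : FreeGroup (I' ⊕ (Jᶜ : Set I)) →* FreeGroup I :=
      FreeGroup.lift (Sum.elim
        (fun i => FreeGroup.map Subtype.val ((basisEquiv hJ).symm ⟨u i, basis_mem hu i⟩))
        (fun j => FreeGroup.of j.1))
    have hf' : f'.comp (FreeGroup.map Subtype.val) = f := by
      ext ⟨i, hi⟩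
      simp only [f', MonoidHom.comp_apply, FreeGroup.map.of, FreeGroup.lift_apply_of]
      rw [dif_pos hi]
    have hfg : f'.comp g = MonoidHom.id _ := by
      ext x
      rcases x with i | ⟨j, hj⟩
      · have : f' (FreeGroup.map Subtype.val ((basisEquiv hJ).symm ⟨u i, basis_mem hu i⟩)) =
            f ((basisEquiv hJ).symm ⟨u i, basis_mem hu i⟩) := by rw [← hf']; rfl
        simp only [MonoidHom.comp_apply, g, FreeGroup.lift_apply_of, Sum.elim_inl, this]
        simp [f, basisEquiv_symm]
      · simp only [MonoidHom.comp_apply, g, FreeGroup.lift_apply_of, Sum.elim_inr, f',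
          MonoidHom.id_apply]
        rw [dif_neg hj]
    have hlift : FreeGroup.lift (Sum.elim u (fun j : (Jᶜ : Set I) => s j)) =
        (FreeGroup.lift s).comp g := by
      ext x
      rcases x with i | j
      · have h1 : (FreeGroup.lift s).comp (FreeGroup.map Subtype.val) =
            FreeGroup.lift (fun j : J => s j) := by ext j; simp
        have h2 : FreeGroup.lift s (FreeGroup.map Subtype.val
            ((basisEquiv hJ).symm ⟨u i, basis_mem hu i⟩)) =
            FreeGroup.lift (fun j : J => s j) ((basisEquiv hJ).symm ⟨u i, basis_mem hu i⟩) := by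
          rw [← h1]; rfl
        simp only [MonoidHom.comp_apply, g, FreeGroup.lift_apply_of, Sum.elim_inl, h2]
        rw [← basisEquiv_coe hJ]; simp
      · simp [g]
    rw [hlift]
    refine h.1.comp ?_
    exact Function.LeftInverse.injective (g := f') (fun x => DFunLike.congr_fun hfg x)
  · rw [Set.Sum.elim_range, Subgroup.closure_union, hu.2, ← h.2]
    rw [← Subgroup.closure_union]
    congr 1
    ext x
    simp only [Set.mem_union, Set.mem_image, Set.mem_range, Subtype.exists]
    constructor
    · rintro (⟨i, -, rfl⟩ | ⟨i, -, rfl⟩) <;> exact ⟨i, rfl⟩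
    · rintro ⟨i, rfl⟩
      by_cases hi : i ∈ J
      · exact Or.inl ⟨i, hi, rfl⟩
      · exact Or.inr ⟨i, hi, rfl⟩

lemma freeFactor_of_basis {G X : Type} [Group G] {b : X → G} (hb : IsFreeBasis b) (S : Set X) :
    IsFreeFactor (Subgroup.closure (b '' S)) := by
  classical
  refine ⟨Subgroup.closure (b '' Sᶜ), ?_⟩
  set A := Subgroup.closure (b '' S) with hA
  set C := Subgroup.closure (b '' Sᶜ) with hC
  let e : FreeGroup X ≃* G := MulEquiv.ofBijective _ hb
  have he : ∀ x, e (FreeGroup.of x) = b x := fun x => FreeGroup.lift_apply_of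
  let φ' : FreeGroup X →* Monoid.Coprod A C := FreeGroup.lift fun x =>
    if hx : x ∈ S then Monoid.Coprod.inl ⟨b x, Subgroup.subset_closure ⟨x, hx, rfl⟩⟩
    else Monoid.Coprod.inr ⟨b x, Subgroup.subset_closure ⟨x, hx, rfl⟩⟩
  let φ : G →* Monoid.Coprod A C := φ'.comp e.symm.toMonoidHom
  have hφ : ∀ x, φ (b x) = if hx : x ∈ S then
      Monoid.Coprod.inl ⟨b x, Subgroup.subset_closure ⟨x, hx, rfl⟩⟩
    else Monoid.Coprod.inr ⟨b x, Subgroup.subset_closure ⟨x, hx, rfl⟩⟩ := by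
    intro x
    have : e.symm (b x) = FreeGroup.of x := by rw [MulEquiv.symm_apply_eq, he]
    simp [φ, φ', this]
  have h1 : ∀ a (ha : a ∈ A), φ a = Monoid.Coprod.inl ⟨a, ha⟩ := by
    intro a ha
    induction ha using Subgroup.closure_induction with
    | mem y hy => obtain ⟨x, hx, rfl⟩ := hy; rw [hφ, dif_pos hx]
    | one => rw [map_one]; exact (map_one _).symm
    | mul y z hy hz ihy ihz => rw [map_mul, ihy, ihz, ← map_mul]; rfl
    | inv y hy ih => rw [map_inv, ih, ← map_inv]; rfl
  have h2 : ∀ a (ha : a ∈ C), φ a = Monoid.Coprod.inr ⟨a, ha⟩ := by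
    intro a ha
    induction ha using Subgroup.closure_induction with
    | mem y hy => obtain ⟨x, hx, rfl⟩ := hy; rw [hφ, dif_neg hx]
    | one => rw [map_one]; exact (map_one _).symm
    | mul y z hy hz ihy ihz => rw [map_mul, ihy, ihz, ← map_mul]; rfl
    | inv y hy ih => rw [map_inv, ih, ← map_inv]; rfl
  constructor
  · have : φ.comp (Monoid.Coprod.lift A.subtype C.subtype) = MonoidHom.id _ := by
      apply Monoid.Coprod.hom_ext
      · ext a; simp [h1]
      · ext a; simp [h2]
    exact Function.LeftInverse.injective (g := φ) (fun x => DFunLike.congr_fun this x)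
  · rw [← MonoidHom.range_eq_top, Monoid.Coprod.range_lift, Subgroup.range_subtype,
      Subgroup.range_subtype, hA, hC, ← Subgroup.closure_union, ← Set.image_union,
      Set.union_compl_self, Set.image_univ, ← FreeGroup.lift_surjective_iff_closure_range_eq_top]
    exact hb.2

lemma freeBasis_iff {G X : Type} [Group G] {b : X → G} : IsFreeBasis b ↔ IsBasisOf b ⊤ := by
  unfold IsFreeBasis IsBasisOf Function.Bijective
  rw [FreeGroup.lift_surjective_iff_closure_range_eq_top]

lemma basis_of_freeFactor {G X : Type} [Group G] {b : X → G} (hb : IsFreeBasis b)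
    {A : Subgroup G} (hA : IsFreeFactor A) :
    ∃ (I : Type) (d : I → G) (S : Set I), IsFreeBasis d ∧ Subgroup.closure (d '' S) = A := by
  obtain ⟨C, hC⟩ := hA
  obtain ⟨I, u, -, hu, -⟩ := kurosh hb A ∅
  obtain ⟨K, w, -, hw, -⟩ := kurosh hb C ∅
  refine ⟨I ⊕ K, Sum.elim u w, Set.range Sum.inl, ?_, ?_⟩
  · let e := MulEquiv.ofBijective _ hC
    let Φ : Monoid.Coprod A C →* FreeGroup (I ⊕ K) := Monoid.Coprod.lift
      ((FreeGroup.map Sum.inl).comp (basisEquiv hu).symm.toMonoidHom)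
      ((FreeGroup.map Sum.inr).comp (basisEquiv hw).symm.toMonoidHom)
    have hu' : ∀ i, e.symm (u i) = Monoid.Coprod.inl ⟨u i, basis_mem hu i⟩ := by
      intro i; rw [MulEquiv.symm_apply_eq]; simp [e]
    have hw' : ∀ i, e.symm (w i) = Monoid.Coprod.inr ⟨w i, basis_mem hw i⟩ := by
      intro i; rw [MulEquiv.symm_apply_eq]; simp [e]
    have : (Φ.comp e.symm.toMonoidHom).comp (FreeGroup.lift (Sum.elim u w)) = MonoidHom.id _ := by
      ext x
      rcases x with i | i
      · simp [Φ, hu', basisEquiv_symm]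
      · simp [Φ, hw', basisEquiv_symm]
    refine ⟨Function.LeftInverse.injective (g := Φ.comp e.symm.toMonoidHom)
      (fun x => DFunLike.congr_fun this x), ?_⟩
    rw [FreeGroup.lift_surjective_iff_closure_range_eq_top, Set.Sum.elim_range,
      Subgroup.closure_union, hu.2, hw.2]
    have := MonoidHom.range_eq_top.2 hC.2
    rwa [Monoid.Coprod.range_lift, Subgroup.range_subtype, Subgroup.range_subtype] at this
  · rw [← Set.range_comp, Sum.elim_comp_inl, hu.2]

lemma chain_basis {G X : Type} [Group G] {b : X → G} (hb : IsFreeBasis b)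
    (C : ℕ → Subgroup G) (hC : Monotone C) (r : ℕ) (hff : ∀ k, k < r → IsFreeFactor (C k)) :
    ∀ k, k ≤ r → ∃ (I : Type) (d : I → G) (l : I → ℕ), IsBasisOf d (C k) ∧ (∀ i, l i ≤ k) ∧
      ∀ j, j ≤ k → Subgroup.closure (d '' {i | l i ≤ j}) = C j := by
  intro k
  induction k with
  | zero =>
    intro _
    obtain ⟨I, u, -, hu, -⟩ := kurosh hb (C 0) ∅
    refine ⟨I, u, fun _ => 0, hu, fun _ => le_rfl, ?_⟩
    intro j hj
    obtain rfl : j = 0 := by omega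
    simpa using hu.2
  | succ k ih =>
    intro hk
    obtain ⟨I, d, l, hd, hl, hlev⟩ := ih (by omega)
    obtain ⟨Y, c, S, hc, hS⟩ := basis_of_freeFactor hb (hff k (by omega))
    obtain ⟨K, s, J, hs, hJ⟩ := kurosh hc (C (k + 1)) S
    rw [hS, inf_eq_right.2 (hC (Nat.le_succ k))] at hJ
    have hB := basis_replace hs J hJ hd
    refine ⟨_, _, Sum.elim l (fun _ => k + 1), hB, ?_, ?_⟩
    · rintro (i | i)
      · exact (hl i).trans (Nat.le_succ k)
      · exact le_rfl
    · intro j hj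
      rcases Nat.lt_or_ge k j with h | h
      · obtain rfl : j = k + 1 := by omega
        rw [← hB.2, ← Set.image_univ]
        congr 2
        ext x
        rcases x with i | i
        · simpa using (hl i).trans (Nat.le_succ k)
        · simp
      · rw [← hlev j h]
        congr 1
        ext x
        simp only [Set.mem_image, Sum.exists, Set.mem_ofPred_eq, Sum.elim_inl, Sum.elim_inr]
        constructor
        · rintro (⟨i, hi, rfl⟩ | ⟨i, hi, -⟩)
          · exact ⟨i, hi, rfl⟩
          · omega
        · rintro ⟨i, hi, rfl⟩
          exact Or.inl ⟨i, hi, rfl⟩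

lemma rank_exists_le {G X : Type} [Group G] {b : X → G} (hb : IsFreeBasis b) {H : Subgroup G}
    (S : Set X) {K : Subgroup G} (hK : Subgroup.closure (b '' S) ≤ K) {m m' : ℕ}
    (hm : HasRank (H ⊓ K) m) (hm' : HasRank (H ⊓ Subgroup.closure (b '' S)) m') : m' ≤ m := by
  obtain ⟨k, hk, hk'⟩ := rank_mono hb hm S
  rw [inf_assoc, inf_eq_right.2 hK] at hk'
  rw [rank_unique hm' hk']; exact hk

lemma prefix_mono {G : Type} [Group G] {n : ℕ} (b : Fin n → G) : Monotone (prefixSubgroup b) := by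
  intro i j hij
  apply Subgroup.closure_mono
  apply Set.image_mono
  intro x hx
  exact lt_of_lt_of_le hx hij

lemma hasRank_bot {G : Type} [Group G] : HasRank (⊥ : Subgroup G) 0 :=
  ⟨{ toFun := fun _ => 1, invFun := fun _ => 1, left_inv := fun _ => Subsingleton.elim _ _,
     right_inv := fun _ => Subsingleton.elim _ _, map_mul' := fun _ _ => by simp }⟩

theorem statement6 {n r : ℕ} (H : Subgroup (FreeGroup (Fin n))) (hH : H.FG)
    (hr : HasRank H r) :
    (∃ b : Fin n → FreeGroup (Fin n), IsEchelonBasis b H) ↔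
    (∃ B : Fin r → Subgroup (FreeGroup (Fin n)), Monotone B ∧
      ∀ i : Fin r, IsFreeFactor (B i) ∧ HasRank (H ⊓ B i) ((i : ℕ) + 1)) := by
  constructor
  · rintro ⟨b, hb, hE⟩
    have hex : ∀ i, ∃ m, HasRank (H ⊓ prefixSubgroup b i) m := by
      intro i
      obtain ⟨m, -, hm⟩ := rank_mono hb hr {j | (j : ℕ) < i}
      exact ⟨m, hm⟩
    choose ρ hρ using hex
    have h0 : ρ 0 = 0 := by
      refine rank_unique (hρ 0) ?_
      have : prefixSubgroup b 0 = ⊥ := by simp [prefixSubgroup]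
      rw [this, inf_bot_eq]; exact hasRank_bot
    have htop : prefixSubgroup b n = ⊤ := by
      rw [← (freeBasis_iff.1 hb).2, prefixSubgroup, ← Set.image_univ]
      congr 2
      ext x; simp
    have hn : ρ n = r := by
      refine rank_unique (hρ n) ?_
      rw [htop, inf_top_eq]; exact hr
    have hstep : ∀ i, i < n → ρ (i + 1) ≤ ρ i + 1 := by
      intro i hi
      obtain ⟨a, a', h1, h2, h3⟩ := hE ⟨i, hi⟩
      rw [rank_unique (hρ (i + 1)) h2, rank_unique (hρ i) h1]; exact h3
    have hfind : ∀ k : Fin r, ∃ i, k.1 + 1 ≤ ρ i := fun k => ⟨n, by rw [hn]; exact k.2⟩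
    classical
    refine ⟨fun k => prefixSubgroup b (Nat.find (hfind k)), ?_, ?_⟩
    · intro k k' hk
      apply prefix_mono
      apply Nat.find_min'
      have := Nat.find_spec (hfind k')
      have h : k.1 ≤ k'.1 := hk
      omega
    · intro k
      refine ⟨freeFactor_of_basis hb _, ?_⟩
      have h1 := Nat.find_spec (hfind k)
      have h2 : Nat.find (hfind k) ≤ n := Nat.find_min' _ (by rw [hn]; exact k.2)
      have h3 : ρ (Nat.find (hfind k)) = k.1 + 1 := by
        rcases hi : Nat.find (hfind k) with _ | i
        · rw [hi, h0] at h1; omega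
        · have h4 := Nat.find_min (hfind k) (m := i) (by omega)
          have h5 := hstep i (by omega)
          rw [hi] at h1
          omega
      rw [← h3]; exact hρ _
  · rintro ⟨B, hB, hBr⟩
    let C : ℕ → Subgroup (FreeGroup (Fin n)) := fun k => if h : k < r then B ⟨k, h⟩ else ⊤
    have hClt : ∀ k (h : k < r), C k = B ⟨k, h⟩ := fun k h => dif_pos h
    have hCr : C r = ⊤ := dif_neg (lt_irrefl r)
    have hC : Monotone C := by
      intro i j hij
      by_cases hj : j < r
      · rw [hClt i (by omega), hClt j hj]; exact hB hij
      · have : C j = ⊤ := dif_neg hj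
        rw [this]; exact le_top
    have hstd : IsFreeBasis (FreeGroup.of : Fin n → FreeGroup (Fin n)) := by
      unfold IsFreeBasis
      rw [FreeGroup.lift_of_eq_id]; exact Function.bijective_id
    obtain ⟨I, d, l, hd, hl, hlev⟩ := chain_basis hstd C hC r
      (fun k hk => by rw [hClt k hk]; exact (hBr _).1) r le_rfl
    rw [hCr] at hd
    have e0 : Fin n ≃ I := Equiv.ofFreeGroupEquiv
      (((basisEquiv hd).trans Subgroup.topEquiv).symm)
    let e : Fin n ≃ I := (Tuple.sort (l ∘ e0)).trans e0
    have he : Monotone (l ∘ e) := Tuple.monotone_sort (l ∘ e0)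
    let b : Fin n → FreeGroup (Fin n) := d ∘ e
    have hb : IsFreeBasis b := by
      rw [freeBasis_iff]
      refine ⟨?_, ?_⟩
      · have : FreeGroup.lift b = (FreeGroup.lift d).comp (FreeGroup.map e) := by
          ext i; simp [b]
        rw [this]
        exact hd.1.comp (FreeGroup.map_injective e.injective)
      · rw [← hd.2]; congr 1
        exact e.surjective.range_comp d
    have hblev : ∀ j, j ≤ r → Subgroup.closure (b '' {i | l (e i) ≤ j}) = C j := by
      intro j hj
      rw [← hlev j hj]
      congr 1
      have : {i | l i ≤ j} = e '' {i | l (e i) ≤ j} := by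
        ext x
        simp only [Set.mem_ofPred_eq, Set.mem_image]
        constructor
        · intro hx; exact ⟨e.symm x, by simpa using hx, by simp⟩
        · rintro ⟨i, hi, rfl⟩; exact hi
      rw [this, ← Set.image_comp]
    have hrank : ∀ j, j ≤ r → ∃ m, m ≤ j + 1 ∧ (j < r → m = j + 1) ∧ HasRank (H ⊓ C j) m := by
      intro j hj
      rcases hj.lt_or_eq with h | rfl
      · exact ⟨j + 1, le_rfl, fun _ => rfl, by rw [hClt j h]; exact (hBr ⟨j, h⟩).2⟩
      · exact ⟨j, Nat.le_succ j, fun h => absurd h (lt_irrefl _), by rw [hCr, inf_top_eq]; exact hr⟩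
    refine ⟨b, hb, fun i => ?_⟩
    obtain ⟨m', -, hm'⟩ := rank_mono hb hr {j | (j : ℕ) < i}
    obtain ⟨m, -, hm⟩ := rank_mono hb hr {j | (j : ℕ) < i + 1}
    refine ⟨m, m', hm', hm, ?_⟩
    have hir : l (e i) ≤ r := hl _
    obtain ⟨a, ha, -, haC⟩ := hrank _ hir
    have h1 : m ≤ a := by
      refine rank_exists_le hb _ ?_ haC hm
      rw [← hblev _ hir]
      apply Subgroup.closure_mono
      apply Set.image_mono
      intro x hx
      have hx' : x ≤ i := by
        have : x.1 < i.1 + 1 := hx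
        exact Fin.le_def.2 (by omega)
      exact he hx'
    rcases hL : l (e i) with _ | L
    · omega
    · have hLr : L < r := by omega
      obtain ⟨a', -, ha', haC'⟩ := hrank L hLr.le
      rw [← hblev L hLr.le] at haC'
      have h2 : a' ≤ m' := by
        refine rank_exists_le hb _ ?_ hm' haC'
        apply Subgroup.closure_mono
        apply Set.image_mono
        intro x hx
        by_contra hxi
        have hix : i ≤ x := Fin.le_def.2 (by simpa using hxi)
        have h3 : l (e i) ≤ l (e x) := he hix
        have h4 : l (e x) ≤ L := hx
        omega
      have := ha' hLr
      omega
end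

section
/- Let H be a finitely generated subgroup of F_n of rank r admitting a flag B_1 ≤ ... ≤ B_r. Then H also admits a minimal flag, i.e. a flag B'_1 ≤ ... ≤ B'_r with the additional property that B'_i is the minimal free factor of F_n containing H ∩ B'_i, for each i. -/
theorem exists_cocycle_s8 {G X Q L : Type} [Group G] [Group L] [MulAction G Q]
    (e : FreeGroup X ≃* G) (ε : X → Q → L) :
    ∃ c : G → Q → L, (∀ x q, c (e (FreeGroup.of x)) q = ε x q) ∧
      ∀ g h q, c (g * h) q = c g (h • q) * c h q := by
  let p : X → Equiv.Perm (Q × L) := fun x =>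
    { toFun := fun z => (e (FreeGroup.of x) • z.1, ε x z.1 * z.2)
      invFun := fun z => ((e (FreeGroup.of x))⁻¹ • z.1, (ε x ((e (FreeGroup.of x))⁻¹ • z.1))⁻¹ * z.2)
      left_inv := fun z => by simp
      right_inv := fun z => by simp }
  let ρ : FreeGroup X →* Equiv.Perm (Q × L) := FreeGroup.lift p
  have key : ∀ w : FreeGroup X, ∀ q, ∃ c : L, ∀ l, ρ w (q, l) = (e w • q, c * l) := by
    intro w
    induction w using FreeGroup.induction_on with
    | C1 => intro q; exact ⟨1, fun l => by simp⟩
    | of x => intro q; exact ⟨ε x q, fun l => by simp [ρ, p]⟩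
    | inv_of x ih =>
      intro q
      obtain ⟨c, hc⟩ := ih ((e (FreeGroup.of x))⁻¹ • q)
      refine ⟨c⁻¹, fun l => ?_⟩
      have h := hc (c⁻¹ * l)
      rw [map_inv, Equiv.Perm.inv_eq_iff_eq, map_inv]
      rw [h]; simp
    | mul w v hw hv =>
      intro q
      obtain ⟨c, hc⟩ := hv q
      obtain ⟨d, hd⟩ := hw (e v • q)
      exact ⟨d * c, fun l => by rw [map_mul, Equiv.Perm.mul_apply, hc, hd, map_mul, mul_smul, mul_assoc]⟩
  choose c hc using key
  refine ⟨fun g q => c (e.symm g) q, fun x q => ?_, fun g h q => ?_⟩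
  · have := hc (FreeGroup.of x) q 1
    simp [ρ, p] at this
    simp [this]
  · have h1 := hc (e.symm (g * h)) q 1
    rw [map_mul, map_mul, Equiv.Perm.mul_apply, hc, hc] at h1
    have := congrArg Prod.snd h1
    simpa using this.symm

/-- `g` is connected to `1` inside `T` by left multiplications by letters of `S`. -/
inductive TreeConn {G : Type} [Group G] (S T : Set G) : G → Prop
  | one : TreeConn S T 1
  | step (s g : G) : TreeConn S T g → g ∈ T → s ∈ S → s * g ∈ T → TreeConn S T (s * g)

theorem TreeConn.mono {G : Type} [Group G] {S S' T T' : Set G} (hS : S ⊆ S') (hT : T ⊆ T') {g : G}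
    (h : TreeConn S T g) : TreeConn S' T' g := by
  induction h with
  | one => exact .one
  | step s g _ h1 h2 h3 ih => exact .step s g ih (hT h1) (hS h2) (hT h3)

theorem TreeConn.mem_closure {G : Type} [Group G] {S T : Set G} {g : G}
    (h : TreeConn S T g) : g ∈ Subgroup.closure S := by
  induction h with
  | one => exact one_mem _
  | step s g _ _ h2 _ ih => exact mul_mem (Subgroup.subset_closure h2) ih

theorem exists_tree {G Q : Type} [Group G] [MulAction G Q] (q₀ : Q) (S T₀ : Set G)
    (hS : ∀ s ∈ S, s⁻¹ ∈ S) (h1 : 1 ∈ T₀) (hinj : Set.InjOn (fun g => g • q₀) T₀)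
    (hc : ∀ g ∈ T₀, TreeConn S T₀ g) :
    ∃ T : Set G, T₀ ⊆ T ∧ Set.InjOn (fun g => g • q₀) T ∧ (∀ g ∈ T, TreeConn S T g) ∧
      ∀ g ∈ Subgroup.closure S, ∃ t ∈ T, t • q₀ = g • q₀ := by
  obtain ⟨T, hT0, hmax⟩ := zorn_subset_nonempty
    {T : Set G | Set.InjOn (fun g => g • q₀) T ∧ ∀ g ∈ T, TreeConn S T g} (by
      intro C hC hchain hne
      refine ⟨⋃₀ C, ⟨?_, ?_⟩, fun s hs => Set.subset_sUnion_of_mem hs⟩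
      · rintro a ⟨s, hs, has⟩ b ⟨t, ht, hbt⟩ hab
        rcases hchain.total hs ht with h | h
        · exact (hC ht).1 (h has) hbt hab
        · exact (hC hs).1 has (h hbt) hab
      · rintro a ⟨s, hs, has⟩
        exact ((hC hs).2 a has).mono le_rfl (Set.subset_sUnion_of_mem hs)) T₀ ⟨hinj, hc⟩
  obtain ⟨hTi, hTc⟩ := hmax.prop
  refine ⟨T, hT0, hTi, hTc, ?_⟩
  have step : ∀ s ∈ S, ∀ q : Q, (∃ t ∈ T, t • q₀ = q) → ∃ t ∈ T, t • q₀ = s • q := by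
    rintro s hs q ⟨t, ht, rfl⟩
    by_contra hno
    have hmem : insert (s * t) T ∈
        {T : Set G | Set.InjOn (fun g => g • q₀) T ∧ ∀ g ∈ T, TreeConn S T g} := by
      have hni : s * t ∉ T := fun h => hno ⟨_, h, mul_smul _ _ _⟩
      refine ⟨(Set.injOn_insert hni).2 ⟨hTi, ?_⟩, ?_⟩
      · rintro ⟨t', ht', h⟩
        exact hno ⟨t', ht', by simpa [mul_smul] using h⟩
      · intro g hg
        have hsub := Set.subset_insert (s * t) T
        rcases hg with rfl | hg
        · exact .step s t ((hTc t ht).mono le_rfl hsub) (hsub ht) hs (Set.mem_insert _ _)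
        · exact (hTc g hg).mono le_rfl hsub
    have := hmax.le_of_ge hmem (Set.subset_insert _ _) (Set.mem_insert _ _)
    exact hno ⟨_, this, mul_smul _ _ _⟩
  have all : ∀ g ∈ Subgroup.closure S, ∀ q : Q, (∃ t ∈ T, t • q₀ = q) → ∃ t ∈ T, t • q₀ = g • q := by
    intro g hg
    induction hg using Subgroup.closure_induction'' with
    | mem x hx => exact step x hx
    | inv_mem x hx => exact step _ (hS x hx)
    | one => intro q h; simpa using h
    | mul x y _ _ hx hy => intro q h; rw [mul_smul]; exact hx _ (hy _ h)
  intro g hg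
  exact all g hg q₀ ⟨1, hT0 h1, one_smul _ _⟩

theorem isFreeFactor_of_equiv {G K : Type} [Group G] [Group K] (A : Subgroup G)
    (e : Monoid.Coprod A K ≃* G) (he : ∀ a : A, e (Monoid.Coprod.inl a) = a) : IsFreeFactor A := by
  let j : K →* G := e.toMonoidHom.comp Monoid.Coprod.inr
  have hj : Function.Injective j := e.injective.comp Monoid.Coprod.inr_injective
  refine ⟨j.range, ?_⟩
  have : (Monoid.Coprod.lift A.subtype j.range.subtype).comp
      (MulEquiv.coprodCongr (MulEquiv.refl A) (MonoidHom.ofInjective hj)).toMonoidHom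
      = e.toMonoidHom := by
    ext x
    · simp [he]
    · change Monoid.Coprod.lift A.subtype j.range.subtype
        (Monoid.Coprod.map (MulEquiv.refl A).toMonoidHom (MonoidHom.ofInjective hj).toMonoidHom
          (Monoid.Coprod.inr x)) = e (Monoid.Coprod.inr x)
      rw [Monoid.Coprod.map_apply_inr, Monoid.Coprod.lift_apply_inr]
      rfl
  have h2 : Function.Bijective ((Monoid.Coprod.lift A.subtype j.range.subtype) ∘
      (MulEquiv.coprodCongr (MulEquiv.refl A) (MonoidHom.ofInjective hj))) := by
    have h3 := e.bijective
    convert h3 using 1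
    funext x
    exact DFunLike.congr_fun this x
  exact (Function.Bijective.of_comp_iff _ (MulEquiv.bijective _)).1 h2

theorem IsFreeFactor.comap_equiv {G G' : Type} [Group G] [Group G'] {A : Subgroup G'}
    (h : IsFreeFactor A) (f : G ≃* G') : IsFreeFactor (A.comap f.toMonoidHom) := by
  obtain ⟨C, hC⟩ := h
  let e := MulEquiv.ofBijective _ hC
  let k : A.comap f.toMonoidHom ≃* A :=
    { toFun := fun x => ⟨f x.1, x.2⟩
      invFun := fun x => ⟨f.symm x.1, by simp⟩
      left_inv := fun x => Subtype.ext (f.symm_apply_apply x.1)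
      right_inv := fun x => Subtype.ext (f.apply_symm_apply x.1)
      map_mul' := fun x y => Subtype.ext (map_mul f x.1 y.1) }
  refine isFreeFactor_of_equiv (K := C) _
    (((MulEquiv.coprodCongr k (MulEquiv.refl C)).trans e).trans f.symm) ?_
  intro a
  change f.symm (Monoid.Coprod.lift A.subtype C.subtype
    (Monoid.Coprod.map k.toMonoidHom (MulEquiv.refl C).toMonoidHom (Monoid.Coprod.inl a))) = a
  rw [Monoid.Coprod.map_apply_inl, Monoid.Coprod.lift_apply_inl]
  exact f.symm_apply_apply a.1

theorem IsFreeFactor.trans {G : Type} [Group G] {A B : Subgroup G} (hAB : A ≤ B)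
    (h : IsFreeFactor (A.subgroupOf B)) (hB : IsFreeFactor B) : IsFreeFactor A := by
  obtain ⟨C, hC⟩ := h
  obtain ⟨D, hD⟩ := hB
  let e := MulEquiv.ofBijective _ hC
  let f := MulEquiv.ofBijective _ hD
  let k := (Subgroup.subgroupOfEquivOfLe hAB).symm
  refine isFreeFactor_of_equiv (K := Monoid.Coprod C D) _
    (((MulEquiv.coprodCongr k (MulEquiv.refl _)).trans
      (MulEquiv.coprodAssoc _ _ _).symm).trans
      ((MulEquiv.coprodCongr e (MulEquiv.refl _)).trans f)) ?_
  intro a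
  simp [e, k, f]

theorem isFreeFactor_closure_of {E : Type} (Z : Set E) :
    IsFreeFactor (Subgroup.closure (FreeGroup.of '' Z)) := by
  classical
  let P := Subgroup.closure (FreeGroup.of '' Z)
  let N := Subgroup.closure (FreeGroup.of '' Zᶜ)
  refine ⟨N, ?_⟩
  let inv : FreeGroup E →* Monoid.Coprod P N := FreeGroup.lift fun x =>
    if h : x ∈ Z then Monoid.Coprod.inl ⟨FreeGroup.of x, Subgroup.subset_closure ⟨x, h, rfl⟩⟩
    else Monoid.Coprod.inr ⟨FreeGroup.of x, Subgroup.subset_closure ⟨x, h, rfl⟩⟩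
  have h1 : (Monoid.Coprod.lift P.subtype N.subtype).comp inv = MonoidHom.id _ := by
    ext x
    by_cases h : x ∈ Z <;> simp [inv, h]
  have hP : ∀ g (hg : g ∈ P), inv g = Monoid.Coprod.inl ⟨g, hg⟩ := by
    intro g hg
    induction hg using Subgroup.closure_induction with
    | mem x hx => obtain ⟨z, hz, rfl⟩ := hx; simp [inv, hz]
    | one => rw [map_one]; exact (map_one _).symm
    | mul x y hx hy ihx ihy => rw [map_mul, ihx, ihy, ← map_mul]; rfl
    | inv x hx ih => rw [map_inv, ih, ← map_inv]; rfl
  have hN : ∀ g (hg : g ∈ N), inv g = Monoid.Coprod.inr ⟨g, hg⟩ := by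
    intro g hg
    induction hg using Subgroup.closure_induction with
    | mem x hx =>
      obtain ⟨z, hz, rfl⟩ := hx
      have hz' : z ∉ Z := hz
      simp [inv, hz']
    | one => rw [map_one]; exact (map_one _).symm
    | mul x y hx hy ihx ihy => rw [map_mul, ihx, ihy, ← map_mul]; rfl
    | inv x hx ih => rw [map_inv, ih, ← map_inv]; rfl
  have h2 : inv.comp (Monoid.Coprod.lift P.subtype N.subtype) = MonoidHom.id _ := by
    refine Monoid.Coprod.hom_ext ?_ ?_
    · refine MonoidHom.ext fun x => ?_
      simpa using hP x.1 x.2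
    · refine MonoidHom.ext fun x => ?_
      simpa using hN x.1 x.2
  exact Function.bijective_iff_has_inverse.2
    ⟨inv, fun x => DFunLike.congr_fun h2 x, fun x => DFunLike.congr_fun h1 x⟩

theorem core_intersection {G X : Type} [Group G] (e : FreeGroup X ≃* G) (Y : Set X)
    (B : Subgroup G) :
    IsFreeFactor ((Subgroup.closure ((fun x => e (FreeGroup.of x)) '' Y)).subgroupOf B) := by
  classical
  let u : X → G := fun x => e (FreeGroup.of x)
  let lett : Set X → Set G := fun Z => {g | ∃ x ∈ Z, g = u x ∨ g = (u x)⁻¹}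
  have hlinv : ∀ Z, ∀ s ∈ lett Z, s⁻¹ ∈ lett Z := by
    rintro Z s ⟨x, hx, rfl | rfl⟩
    · exact ⟨x, hx, Or.inr rfl⟩
    · exact ⟨x, hx, Or.inl (inv_inv _)⟩
  have hlcl : ∀ Z, Subgroup.closure (lett Z) = Subgroup.closure (u '' Z) := by
    intro Z
    apply le_antisymm
    · rw [Subgroup.closure_le]
      rintro s ⟨x, hx, rfl | rfl⟩
      · exact Subgroup.subset_closure ⟨x, hx, rfl⟩
      · exact inv_mem (Subgroup.subset_closure ⟨x, hx, rfl⟩)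
    · apply Subgroup.closure_mono
      rintro _ ⟨x, hx, rfl⟩
      exact ⟨x, hx, Or.inl rfl⟩
  have htop : Subgroup.closure (u '' Set.univ) = ⊤ := by
    rw [Set.image_univ]
    have : Set.range u = e.toMonoidHom '' Set.range FreeGroup.of := by
      rw [← Set.range_comp]; rfl
    rw [this, ← MonoidHom.map_closure, FreeGroup.closure_range_of]
    exact Subgroup.map_top_of_surjective _ e.surjective
  let A := Subgroup.closure (u '' Y)
  change IsFreeFactor (A.subgroupOf B)
  let q₀ : G ⧸ B := ((1 : G) : G ⧸ B)
  have hq₀ : ∀ g : G, g • q₀ = (g : G ⧸ B) := fun g => by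
    change ((g * 1 : G) : G ⧸ B) = _
    rw [mul_one]
  have hstab : ∀ g : G, g • q₀ = q₀ ↔ g ∈ B := fun g => by
    rw [hq₀, eq_comm]
    simp [q₀, QuotientGroup.eq]
  obtain ⟨T₁, hT₁1, hT₁i, hT₁c, hT₁s⟩ := exists_tree q₀ (lett Y) {1} (hlinv Y) rfl
    (Set.injOn_singleton _ _) (by rintro g rfl; exact .one)
  have hone : (1 : G) ∈ T₁ := hT₁1 rfl
  obtain ⟨T, hT1, hTi, hTc, hTs⟩ := exists_tree q₀ (lett Set.univ) T₁ (hlinv _) hone hT₁i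
    (fun g hg => (hT₁c g hg).mono
      (by rintro s ⟨x, _, h⟩; exact ⟨x, trivial, h⟩) le_rfl)
  have hcov : ∀ q : G ⧸ B, ∃ t ∈ T, t • q₀ = q := by
    intro q
    obtain ⟨g, rfl⟩ := QuotientGroup.mk_surjective q
    rw [← hq₀]
    exact hTs g (by rw [hlcl, htop]; trivial)
  choose t htT ht using hcov
  have htu : ∀ g ∈ T, t (g • q₀) = g := fun g hg => hTi (htT _) hg (ht _)
  have htA : ∀ a ∈ A, t (a • q₀) ∈ A := by
    intro a ha
    obtain ⟨s, hs, hsa⟩ := hT₁s a (by rw [hlcl]; exact ha)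
    rw [← hsa, htu s (hT1 hs)]
    have := (hT₁c s hs).mem_closure
    rwa [hlcl] at this
  have ht1 : t q₀ = 1 := by simpa using htu 1 (hT1 hone)
  -- the loops
  let loop : X → G ⧸ B → G := fun x q => (t (u x • q))⁻¹ * u x * t q
  let E := {z : X × (G ⧸ B) // loop z.1 z.2 ≠ 1}
  let ε : X → G ⧸ B → FreeGroup E := fun x q =>
    if h : loop x q ≠ 1 then FreeGroup.of ⟨(x, q), h⟩ else 1
  obtain ⟨c, hcu, hcm⟩ := exists_cocycle_s8 (Q := G ⧸ B) e ε
  have hc1 : ∀ q, c 1 q = 1 := fun q => by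
    have := hcm 1 1 q
    rw [one_smul, mul_one] at this
    exact (mul_eq_left.1 this.symm)
  have hcinv : ∀ g q, c g⁻¹ q = (c g (g⁻¹ • q))⁻¹ := fun g q => by
    have := hcm g g⁻¹ q
    rw [mul_inv_cancel, hc1] at this
    exact eq_inv_of_mul_eq_one_right this.symm
  have hcu' : ∀ x q, c (u x) q = ε x q := hcu
  have hloopB : ∀ x q, loop x q ∈ B := by
    intro x q
    rw [← hstab]
    simp only [loop, mul_smul]
    rw [ht, inv_smul_eq_iff, ht]
  let ψ : FreeGroup E →* G := FreeGroup.lift fun z => loop z.1.1 z.1.2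
  have hψε : ∀ x q, ψ (ε x q) = loop x q := by
    intro x q
    by_cases h : loop x q = 1
    · simp [ε, h]
    · simp [ε, h, ψ]
  have hψc : ∀ g q, ψ (c g q) = (t (g • q))⁻¹ * g * t q := by
    intro g
    have hg : g ∈ Subgroup.closure (u '' Set.univ) := by rw [htop]; trivial
    induction hg using Subgroup.closure_induction with
    | mem x hx =>
      obtain ⟨x, _, rfl⟩ := hx
      intro q
      rw [hcu', hψε]
    | one => intro q; rw [hc1, map_one, one_smul]; group
    | mul x y _ _ hx hy => intro q; rw [hcm, map_mul, hx, hy, mul_smul]; group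
    | inv x _ hx => intro q; rw [hcinv, map_inv, hx, smul_inv_smul]; group
  have hlett : ∀ s ∈ lett Set.univ, ∀ q, t (s • q) = s * t q → c s q = 1 := by
    rintro s ⟨x, _, rfl | rfl⟩ q h
    · rw [hcu']
      have : loop x q = 1 := by simp only [loop]; rw [h]; group
      simp [ε, this]
    · rw [hcinv, hcu']
      have : loop x ((u x)⁻¹ • q) = 1 := by
        simp only [loop]; rw [smul_inv_smul, h]; group
      simp [ε, this]
  have htree : ∀ g, TreeConn (lett Set.univ) T g → c g q₀ = 1 := by
    intro g hg
    induction hg with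
    | one => exact hc1 _
    | step s g _ h1 h2 h3 ih =>
      rw [hcm, ih, mul_one]
      apply hlett s h2
      rw [← mul_smul, htu _ h3, htu _ h1]
  have hct : ∀ q, c (t q) q₀ = 1 := fun q => htree _ (hTc _ (htT q))
  let φ : B →* FreeGroup E :=
    { toFun := fun b => c b q₀
      map_one' := hc1 _
      map_mul' := fun a b => by
        change c (a * b : G) q₀ = _
        rw [hcm, (hstab b).2 b.2] }
  have hψB : ∀ w, ψ w ∈ B := by
    intro w
    have : ψ.range ≤ B := by
      rw [FreeGroup.range_lift_eq_closure, Subgroup.closure_le]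
      rintro _ ⟨z, rfl⟩
      exact hloopB _ _
    exact this ⟨w, rfl⟩
  let ψB : FreeGroup E →* B := ψ.codRestrict B hψB
  have h1 : ∀ b : B, ψB (φ b) = b := by
    intro b
    apply Subtype.ext
    change ψ (c b q₀) = b
    rw [hψc, (hstab b).2 b.2, ht1]; group
  have h2 : φ.comp ψB = MonoidHom.id _ := by
    ext z
    change c (ψ (FreeGroup.of z)) q₀ = FreeGroup.of z
    obtain ⟨⟨x, q⟩, hz⟩ := z
    have hz' : loop x q ≠ 1 := hz
    have : ψ (FreeGroup.of ⟨(x, q), hz⟩) = loop x q := by simp [ψ]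
    rw [this]
    simp only [loop]
    rw [hcm, hct, mul_one, ht, hcm, hcu', hcinv]
    have h3 : (t (u x • q))⁻¹ • u x • q = q₀ := by rw [inv_smul_eq_iff, ht]
    rw [h3, hct, inv_one, one_mul]
    simp [ε, hz']
  let Φ : B ≃* FreeGroup E :=
    { toFun := φ, invFun := ψB, left_inv := h1, right_inv := fun w => DFunLike.congr_fun h2 w
      map_mul' := φ.map_mul }
  let Z : Set E := {z | z.1.1 ∈ Y ∧ ∃ a ∈ A, a • q₀ = z.1.2}
  have hcA : ∀ a ∈ A, ∀ q, (∃ a ∈ A, a • q₀ = q) →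
      c a q ∈ Subgroup.closure (FreeGroup.of '' Z) := by
    intro a ha
    induction ha using Subgroup.closure_induction with
    | mem x hx =>
      obtain ⟨x, hxY, rfl⟩ := hx
      intro q hq
      rw [hcu']
      by_cases h : loop x q = 1
      · simp [ε, h]
      · simp only [ε, ne_eq, h, not_false_eq_true, dite_true]
        exact Subgroup.subset_closure ⟨_, ⟨hxY, hq⟩, rfl⟩
    | one => intro q _; rw [hc1]; exact one_mem _
    | mul x y _ hyA hx hy =>
      rintro q ⟨a, ha, rfl⟩
      rw [hcm]
      exact mul_mem (hx _ ⟨y * a, mul_mem hyA ha, mul_smul _ _ _⟩) (hy _ ⟨a, ha, rfl⟩)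
    | inv x hxA hx =>
      rintro q ⟨a, ha, rfl⟩
      rw [hcinv]
      exact inv_mem (hx _ ⟨x⁻¹ * a, mul_mem (inv_mem hxA) ha, mul_smul _ _ _⟩)
  have hψA : Subgroup.closure (FreeGroup.of '' Z) ≤ A.comap ψ := by
    rw [Subgroup.closure_le]
    rintro _ ⟨⟨⟨x, q⟩, hz⟩, ⟨hxY, a, ha, haq⟩, rfl⟩
    have hxY' : x ∈ Y := hxY
    have haq' : a • q₀ = q := haq
    change ψ (FreeGroup.of _) ∈ A
    have : ψ (FreeGroup.of ⟨(x, q), hz⟩) = loop x q := by simp [ψ]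
    rw [this]
    have hxA : u x ∈ A := Subgroup.subset_closure ⟨x, hxY', rfl⟩
    simp only [loop]
    rw [← haq', ← mul_smul]
    exact mul_mem (mul_mem (inv_mem (htA _ (mul_mem hxA ha))) hxA) (htA _ ha)
  have hfin : A.subgroupOf B = (Subgroup.closure (FreeGroup.of '' Z)).comap Φ.toMonoidHom := by
    ext b
    rw [Subgroup.mem_subgroupOf, Subgroup.mem_comap]
    constructor
    · intro hb
      exact hcA b hb q₀ ⟨1, one_mem _, one_smul _ _⟩
    · intro hb
      have := hψA hb
      have h3 : ψ (φ b) = b := congrArg Subtype.val (h1 b)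
      change ψ (φ b) ∈ A at this
      rwa [h3] at this
  rw [hfin]
  exact (isFreeFactor_closure_of Z).comap_equiv Φ

theorem IsFreeFactor.subgroupOf {G : Type} [Group G] [IsFreeGroup G] {A : Subgroup G}
    (hA : IsFreeFactor A) (B : Subgroup G) : IsFreeFactor (A.subgroupOf B) := by
  obtain ⟨C, hC⟩ := hA
  let a := IsFreeGroup.mulEquiv A
  let d := IsFreeGroup.mulEquiv C
  let f := MulEquiv.ofBijective _ hC
  let ι := IsFreeGroup.Generators A
  let κ := IsFreeGroup.Generators C
  let e₀ : FreeGroup (ι ⊕ κ) ≃* Monoid.Coprod (FreeGroup ι) (FreeGroup κ) :=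
    MonoidHom.toMulEquiv
      (FreeGroup.lift (Sum.elim (fun i => Monoid.Coprod.inl (FreeGroup.of i))
        (fun i => Monoid.Coprod.inr (FreeGroup.of i))))
      (Monoid.Coprod.lift (FreeGroup.lift fun i => FreeGroup.of (Sum.inl i))
        (FreeGroup.lift fun i => FreeGroup.of (Sum.inr i)))
      (by ext (i | i) <;> simp) (by ext i <;> simp)
  let e : FreeGroup (ι ⊕ κ) ≃* G := (e₀.trans (MulEquiv.coprodCongr a d)).trans f
  have he : ∀ i : ι, e (FreeGroup.of (Sum.inl i)) = (a (FreeGroup.of i) : G) := by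
    intro i; simp [e, e₀, f]
  have hcl : Subgroup.closure ((fun x => e (FreeGroup.of x)) '' Set.range Sum.inl) = A := by
    have h1 : (fun x => e (FreeGroup.of x)) '' Set.range Sum.inl
        = (A.subtype.comp a.toMonoidHom) '' Set.range FreeGroup.of := by
      rw [← Set.range_comp, ← Set.range_comp]
      exact congrArg Set.range (funext he)
    rw [h1, ← MonoidHom.map_closure, FreeGroup.closure_range_of, ← MonoidHom.range_eq_map,
      MonoidHom.range_comp]
    rw [MonoidHom.range_eq_top.2 a.surjective]
    rw [← MonoidHom.range_eq_map, Subgroup.range_subtype]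
  have := core_intersection e (Set.range Sum.inl) B
  rwa [hcl] at this

theorem IsFreeFactor.inf {G : Type} [Group G] [IsFreeGroup G] {A B : Subgroup G}
    (hA : IsFreeFactor A) (hB : IsFreeFactor B) : IsFreeFactor (A ⊓ B) := by
  refine IsFreeFactor.trans inf_le_right ?_ hB
  rw [Subgroup.inf_subgroupOf_right]
  exact hA.subgroupOf B

theorem card_hom_lt {n : ℕ} {A B : Subgroup (FreeGroup (Fin n))} (hA : IsFreeFactor A)
    (hB : IsFreeFactor B) (h : A < B) :
    Nat.card (A →* Multiplicative (ZMod 2)) < Nat.card (B →* Multiplicative (ZMod 2)) := by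
  let M := Multiplicative (ZMod 2)
  have fin : ∀ C : Subgroup (FreeGroup (Fin n)), IsFreeFactor C → Finite (C →* M) := by
    rintro C ⟨D, hD⟩
    let f := MulEquiv.ofBijective _ hD
    have : Finite (FreeGroup (Fin n) →* M) := Finite.of_equiv _ (FreeGroup.lift (β := M) (α := Fin n))
    refine Finite.of_injective
      (fun g : C →* M => ((Monoid.Coprod.lift g 1).comp f.symm.toMonoidHom :
        FreeGroup (Fin n) →* M)) ?_
    intro g g' hg
    ext c
    have := DFunLike.congr_fun hg (f (Monoid.Coprod.inl c))
    simpa using this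
  have := fin B hB
  obtain ⟨C, hC⟩ := hA.subgroupOf B
  let f := MulEquiv.ofBijective _ hC
  let k := Subgroup.subgroupOfEquivOfLe h.le
  have hk : ∀ a, ((k a : A) : FreeGroup (Fin n)) = a.1 := fun a => rfl
  let F : (A →* M) → (B →* M) := fun g =>
    (Monoid.Coprod.lift (g.comp k.toMonoidHom) 1).comp f.symm.toMonoidHom
  have hF : Function.Injective F := by
    intro g g' hg
    ext a
    have := DFunLike.congr_fun hg (f (Monoid.Coprod.inl (k.symm a)))
    simpa [F] using this
  have hgen : Nonempty (IsFreeGroup.Generators C) := by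
    by_contra hne
    rw [not_nonempty_iff] at hne
    have hsub : Subsingleton C := (IsFreeGroup.mulEquiv C).symm.injective.subsingleton
    apply h.not_ge
    intro b hb
    obtain ⟨w, hw⟩ := f.surjective ⟨b, hb⟩
    have hall : ∀ w, ((f w : B) : FreeGroup (Fin n)) ∈ A := by
      intro w
      induction w using Monoid.Coprod.induction_on with
      | inl a =>
        have ha : (a.1 : FreeGroup (Fin n)) ∈ A := a.2
        simpa [f] using ha
      | inr c => simp [Subsingleton.elim c 1]
      | mul x y hx hy => simpa using mul_mem hx hy
    have := hall w
    rwa [hw] at this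
  obtain ⟨i⟩ := hgen
  let p : C →* M := IsFreeGroup.lift fun _ => Multiplicative.ofAdd 1
  have hp : p (IsFreeGroup.of i) ≠ 1 := by
    simp only [p, IsFreeGroup.lift_of]
    decide
  let P : B →* M := (Monoid.Coprod.lift 1 p).comp f.symm.toMonoidHom
  have hFP : P ∉ Set.range F := by
    rintro ⟨g, hg⟩
    have := DFunLike.congr_fun hg (f (Monoid.Coprod.inr (IsFreeGroup.of i)))
    apply hp
    simpa [F, P] using this.symm
  by_contra hle
  exact hFP ((hF.bijective_of_nat_card_le (not_lt.1 hle)).2 P)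

theorem exists_ffSupport {n : ℕ} (K : Subgroup (FreeGroup (Fin n)))
    (h : ∃ B, IsFreeFactor B ∧ K ≤ B) : ∃ B, IsFFSupport K B := by
  obtain ⟨B, ⟨hB, hKB⟩, hmin⟩ := exists_minimalFor_of_wellFoundedLT
    (fun B : Subgroup (FreeGroup (Fin n)) => IsFreeFactor B ∧ K ≤ B)
    (fun B => Nat.card (B →* Multiplicative (ZMod 2))) h
  refine ⟨B, hB, hKB, fun B' hB' hK => ?_⟩
  have hi := hB'.inf hB
  by_contra hlt
  have hlt' : B' ⊓ B < B := lt_of_le_of_ne inf_le_right fun h => hlt (inf_eq_right.1 h)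
  have h1 := card_hom_lt hi hB hlt'
  exact absurd (hmin ⟨hi, le_inf hK hKB⟩ h1.le) (not_le.2 h1)

theorem statement8 {n r : ℕ} (H : Subgroup (FreeGroup (Fin n))) (hH : H.FG)
    (hr : HasRank H r)
    (B : Fin r → Subgroup (FreeGroup (Fin n))) (hmono : Monotone B)
    (hflag : ∀ i : Fin r, IsFreeFactor (B i) ∧ HasRank (H ⊓ B i) ((i : ℕ) + 1)) :
    ∃ B' : Fin r → Subgroup (FreeGroup (Fin n)), Monotone B' ∧
      ∀ i : Fin r, IsFreeFactor (B' i) ∧ HasRank (H ⊓ B' i) ((i : ℕ) + 1) ∧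
        IsFFSupport (H ⊓ B' i) (B' i) := by
  have hex : ∀ i, ∃ B', IsFFSupport (H ⊓ B i) B' := fun i =>
    exists_ffSupport _ ⟨B i, (hflag i).1, inf_le_right⟩
  choose B' hB' using hex
  have heq : ∀ i, H ⊓ B' i = H ⊓ B i := fun i =>
    le_antisymm (inf_le_inf_left _ ((hB' i).2.2 _ (hflag i).1 inf_le_right))
      (le_inf inf_le_left (hB' i).2.1)
  refine ⟨B', fun i j hij => ?_, fun i => ⟨(hB' i).1, ?_, ?_⟩⟩
  · exact (hB' i).2.2 _ (hB' j).1 ((inf_le_inf_left _ (hmono hij)).trans (hB' j).2.1)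
  · rw [heq]; exact (hflag i).2
  · rw [heq]; exact hB' i
end
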